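/- arXiv:1307.3582 — 2 statements merged into one kernel-verified Lean document; each statement's English description precedes it below -/
import Mathlib

section
/- With the explicit constants d = 10^{11} and ε = 10^{-11}, the probability that Y ∈ 𝓨(n,d) satisfies h_1(Y) > ε tends to 1 as n → ∞. -/
open Finset
open scoped Classical

noncomputable section

/-- A Latin square of order `n`: an `n`-tuple `(π_1,…,π_n)` of permutations of `[n]`
such that `π_i ∘ π_j⁻¹` is fixed-point-free for all `i ≠ j`. -/
def IsLatinSquare {n : ℕ} (L : Fin n → Equiv.Perm (Fin n)) : Prop :=
  ∀ i j : Fin n, i ≠ j → ∀ x : Fin n, L i x ≠ L j x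

/-- The (finite) space of Latin squares of order `n`. -/
abbrev LatinSquare (n : ℕ) := {L : Fin n → Equiv.Perm (Fin n) // IsLatinSquare L}

/-- A `1`-cochain of the complete `3`-partite complex `T_n` (whose vertex set is
`V_1 ∪ V_2 ∪ V_3`, three copies of `Fin n`), recorded by its values on the three
kinds of edges `a_i b_j`, `a_i c_k`, `b_j c_k`. -/
structure Cochain1 (n : ℕ) where
  ab : Fin n → Fin n → ZMod 2
  ac : Fin n → Fin n → ZMod 2
  bc : Fin n → Fin n → ZMod 2

instance {n : ℕ} : Add (Cochain1 n) :=
  ⟨fun φ η => ⟨fun i j => φ.ab i j + η.ab i j, fun i k => φ.ac i k + η.ac i k,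
    fun j k => φ.bc j k + η.bc j k⟩⟩

/-- The coboundary of a `0`-cochain on `T_n`; vertices are indexed by `Fin 3 × Fin n`. -/
def d0 {n : ℕ} (ψ : Fin 3 × Fin n → ZMod 2) : Cochain1 n :=
  ⟨fun i j => ψ (0, i) + ψ (1, j), fun i k => ψ (0, i) + ψ (2, k),
   fun j k => ψ (1, j) + ψ (2, k)⟩

/-- `φ ∈ B^1`, i.e. `φ` is a `1`-coboundary. -/
def IsCobound1 {n : ℕ} (φ : Cochain1 n) : Prop := ∃ ψ, φ = d0 ψ

/-- `‖φ‖ = |supp φ|` for a `1`-cochain. -/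
def norm1 {n : ℕ} (φ : Cochain1 n) : ℕ :=
  (univ.filter fun p : Fin n × Fin n => φ.ab p.1 p.2 ≠ 0).card +
    (univ.filter fun p : Fin n × Fin n => φ.ac p.1 p.2 ≠ 0).card +
    (univ.filter fun p : Fin n × Fin n => φ.bc p.1 p.2 ≠ 0).card

/-- `‖[φ]‖ = min {‖φ + d_0 ψ‖ : ψ ∈ C^0}`. -/
def normClass1 {n : ℕ} (φ : Cochain1 n) : ℕ :=
  sInf (Set.range fun ψ : Fin 3 × Fin n → ZMod 2 => norm1 (φ + d0 ψ))

/-- The coboundary of a `1`-cochain evaluated on the triangle `[a_i, b_j, c_k]`. -/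
def d1 {n : ℕ} (φ : Cochain1 n) (i j k : Fin n) : ZMod 2 :=
  φ.ab i j + φ.ac i k + φ.bc j k

/-- The set of `2`-simplices `[a_i, b_j, c_{π_{mi}(j)}]` of `Y(L_1,…,L_d)`. -/
def triangles {n d : ℕ} (Ls : Fin d → LatinSquare n) : Finset (Fin n × Fin n × Fin n) :=
  univ.filter fun t => ∃ m : Fin d, ((Ls m).1 t.1) t.2.1 = t.2.2

/-- `‖d_1 φ‖_Y`, where `Y ⊆ T_n` has full `1`-skeleton and triangle set `T`. -/
def normd1 {n : ℕ} (T : Finset (Fin n × Fin n × Fin n)) (φ : Cochain1 n) : ℕ :=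
  (T.filter fun t => d1 φ t.1 t.2.1 t.2.2 ≠ 0).card

/-- The first coboundary expansion constant `h_1(Y)` of the subcomplex `Y ⊆ T_n` with
full `1`-skeleton and triangle set `T`:
`h_1 = min { ‖d_1 φ‖ / ‖[φ]‖ : φ ∈ C^1 ∖ B^1 }`. -/
def h1 {n : ℕ} (T : Finset (Fin n × Fin n × Fin n)) : ℝ :=
  sInf {r : ℝ | ∃ φ : Cochain1 n, ¬ IsCobound1 φ ∧
    r = (normd1 T φ : ℝ) / (normClass1 φ : ℝ)}


section VdW
open Polynomial

lemma vw_prod_le (t : ℝ) (ht : 0 ≤ t) (M : Multiset ℂ) (hM : ∀ r ∈ M, ∃ ρ : ℝ, 0 < ρ ∧ r = -(ρ : ℂ)) :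
    ‖(M.map (fun r => (t : ℂ) - r)).prod‖ ≤
      ‖(M.map (fun r => (0 : ℂ) - r)).prod‖ * Real.exp (t * (M.map (fun r => 1 / ‖r‖)).sum) := by
  induction M using Multiset.induction_on with
  | empty => simp
  | cons a M ih =>
    have ih := ih (fun r hr => hM r (Multiset.mem_cons_of_mem hr))
    obtain ⟨ρ, hρ, rfl⟩ := hM a (Multiset.mem_cons_self a M)
    simp only [Multiset.map_cons, Multiset.prod_cons, Multiset.sum_cons, norm_mul]
    have h1 : ‖(t : ℂ) - -(ρ : ℂ)‖ = t + ρ := by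
      rw [sub_neg_eq_add, ← Complex.ofReal_add, Complex.norm_real, Real.norm_of_nonneg (by positivity)]
    have h2 : ‖(0 : ℂ) - -(ρ : ℂ)‖ = ρ := by
      rw [sub_neg_eq_add, zero_add, Complex.norm_real, Real.norm_of_nonneg (by positivity)]
    have h3 : ‖-(ρ : ℂ)‖ = ρ := by
      rw [norm_neg, Complex.norm_real, Real.norm_of_nonneg (by positivity)]
    rw [h1, h2, h3, mul_add, Real.exp_add]
    have h4 : t + ρ ≤ ρ * Real.exp (t * (1 / ρ)) := by
      have := Real.add_one_le_exp (t * (1 / ρ))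
      calc t + ρ = ρ * (t * (1 / ρ) + 1) := by field_simp
        _ ≤ _ := by gcongr
    calc (t + ρ) * _ ≤ (ρ * Real.exp (t * (1 / ρ))) * _ := by
          apply mul_le_mul h4 ih (norm_nonneg _) (by positivity)
      _ = _ := by ring

lemma vw_sum_eq (M : Multiset ℂ) (hM : ∀ r ∈ M, ∃ ρ : ℝ, 0 < ρ ∧ r = -(ρ : ℂ)) :
    (M.map (fun r => 1 / ((0 : ℂ) - r))).sum = (((M.map (fun r => 1 / ‖r‖)).sum : ℝ) : ℂ) := by
  induction M using Multiset.induction_on with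
  | empty => simp
  | cons a M ih =>
    have ih := ih (fun r hr => hM r (Multiset.mem_cons_of_mem hr))
    obtain ⟨ρ, hρ, rfl⟩ := hM a (Multiset.mem_cons_self a M)
    have h3 : ‖-(ρ : ℂ)‖ = ρ := by
      rw [norm_neg, Complex.norm_real, Real.norm_of_nonneg (by positivity)]
    simp only [Multiset.map_cons, Multiset.sum_cons, ih, h3]
    push_cast
    simp

lemma vw_sum_pos (M : Multiset ℂ) (h0 : M ≠ 0) (hM : ∀ r ∈ M, ∃ ρ : ℝ, 0 < ρ ∧ r = -(ρ : ℂ)) :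
    0 < (M.map (fun r => 1 / ‖r‖)).sum := by
  obtain ⟨a, ha⟩ := Multiset.exists_mem_of_ne_zero h0
  obtain ⟨M', rfl⟩ := Multiset.exists_cons_of_mem ha
  obtain ⟨ρ, hρ, rfl⟩ := hM _ ha
  simp only [Multiset.map_cons, Multiset.sum_cons]
  have h3 : ‖-(ρ : ℂ)‖ = ρ := by
    rw [norm_neg, Complex.norm_real, Real.norm_of_nonneg (by positivity)]
  rw [h3]
  have : 0 ≤ (M'.map (fun r => 1 / ‖r‖)).sum := by
    apply Multiset.sum_nonneg
    intro x hx
    obtain ⟨r, _, rfl⟩ := Multiset.mem_map.1 hx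
    positivity
  positivity

lemma vw_uni (R : ℂ[X]) (hdeg : 0 < R.degree)
    (hroots : ∀ r ∈ R.roots, ∃ ρ : ℝ, 0 < ρ ∧ r = -(ρ : ℂ)) (K : ℝ)
    (hK : ∀ t : ℝ, 0 < t → K * t ≤ ‖R.eval (t : ℂ)‖) :
    K * Real.exp (-1) ≤ ‖R.coeff 1‖ := by
  have hsp : R.Splits := IsAlgClosed.splits R
  have hR0 : R ≠ 0 := by rintro rfl; simp at hdeg
  have hne : R.roots ≠ 0 := by
    obtain ⟨z, hz⟩ := Complex.exists_root hdeg
    intro h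
    have : z ∈ R.roots := (mem_roots hR0).2 hz
    rw [h] at this; simp at this
  set s := (R.roots.map (fun r => 1 / ‖r‖)).sum with hs
  have hspos : 0 < s := vw_sum_pos _ hne hroots
  have he0 : R.eval 0 ≠ 0 := by
    intro h
    obtain ⟨ρ, hρ, h'⟩ := hroots 0 ((mem_roots hR0).2 h)
    have : (ρ : ℂ) = 0 := by
      have := congrArg Neg.neg h'
      simpa using this.symm
    exact hρ.ne' (by exact_mod_cast this)
  have hd : R.coeff 1 = R.eval 0 * (s : ℂ) := by
    have h1 : R.derivative.eval 0 = R.coeff 1 := by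
      rw [← coeff_zero_eq_eval_zero, coeff_derivative]; simp
    rw [← h1, hsp.eval_derivative_eq_eval_mul_sum he0, vw_sum_eq _ hroots]
  have hle := hK (1 / s) (by positivity)
  have h2 : ‖R.eval ((1 / s : ℝ) : ℂ)‖ ≤ ‖R.eval 0‖ * Real.exp 1 := by
    rw [hsp.eval_eq_prod_roots, hsp.eval_eq_prod_roots, norm_mul, norm_mul, mul_assoc]
    have := vw_prod_le (1 / s) (by positivity) R.roots hroots
    rw [← hs, one_div_mul_cancel hspos.ne'] at this
    gcongr
  rw [hd, norm_mul, Complex.norm_real, Real.norm_of_nonneg hspos.le, Real.exp_neg]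
  have h3 : K * (1 / s) ≤ ‖R.eval 0‖ * Real.exp 1 := hle.trans h2
  rw [mul_one_div, div_le_iff₀ hspos] at h3
  rw [← div_eq_mul_inv, div_le_iff₀ (Real.exp_pos 1)]
  linarith

lemma vw_hom_eval {m k : ℕ} (p : MvPolynomial (Fin m) ℂ) (hp : p.IsHomogeneous k) (c : ℂ)
    (z : Fin m → ℂ) : MvPolynomial.eval (fun i => c * z i) p = c ^ k * MvPolynomial.eval z p := by
  rw [MvPolynomial.eval_eq, MvPolynomial.eval_eq, Finset.mul_sum]
  refine Finset.sum_congr rfl fun d hd => ?_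
  have h := hp.degree_eq_sum_deg_support hd
  simp only [mul_pow, Finset.prod_mul_distrib]
  rw [Finset.prod_pow_eq_pow_sum]
  rw [← h]
  ring

def VStab {m : ℕ} (p : MvPolynomial (Fin m) ℂ) : Prop :=
  ∀ z : Fin m → ℂ, (∀ i, 0 ≤ (z i).re) → (∃ i, 0 < (z i).re) → MvPolynomial.eval z p ≠ 0

lemma vw_deg {m : ℕ} (p : MvPolynomial (Fin (m + 1)) ℂ) (hp : p.IsHomogeneous (m + 1))
    (hs : VStab p) (z : Fin m → ℂ) :
    0 < (Polynomial.map (MvPolynomial.eval z) (MvPolynomial.finSuccEquiv ℂ m p)).degree := by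
  have hc : ((MvPolynomial.finSuccEquiv ℂ m p).coeff (m + 1)).IsHomogeneous 0 :=
    hp.finSuccEquiv_coeff_isHomogeneous (m + 1) 0 rfl
  rw [← MvPolynomial.totalDegree_zero_iff_isHomogeneous, MvPolynomial.totalDegree_eq_zero_iff_eq_C] at hc
  set c := MvPolynomial.coeff 0 ((MvPolynomial.finSuccEquiv ℂ m p).coeff (m + 1)) with hcdef
  have hcne : c ≠ 0 := by
    set a := MvPolynomial.eval (Fin.cons 1 (fun _ => 0) : Fin (m + 1) → ℂ) p with ha
    have hane : a ≠ 0 := by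
      apply hs
      · intro i; refine Fin.cases ?_ (fun i => ?_) i <;> simp
      · exact ⟨0, by simp⟩
    have hR : Polynomial.map (MvPolynomial.eval (fun _ : Fin m => (0 : ℂ))) (MvPolynomial.finSuccEquiv ℂ m p)
        = Polynomial.C a * Polynomial.X ^ (m + 1) := by
      apply Polynomial.funext
      intro t
      rw [← MvPolynomial.eval_eq_eval_mv_eval']
      have := vw_hom_eval p hp t (Fin.cons 1 (fun _ => 0))
      rw [← ha] at this
      have h2 : (fun i => t * (Fin.cons 1 (fun _ => 0) : Fin (m + 1) → ℂ) i)
          = (Fin.cons t (fun _ => 0) : Fin (m + 1) → ℂ) := by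
        funext i; refine Fin.cases ?_ (fun i => ?_) i <;> simp
      rw [h2] at this
      rw [this, Polynomial.eval_mul, Polynomial.eval_C, Polynomial.eval_pow, Polynomial.eval_X, mul_comm]
    have h3 := congrArg (fun q => Polynomial.coeff q (m + 1)) hR
    simp only [Polynomial.coeff_map, Polynomial.coeff_C_mul, Polynomial.coeff_X_pow] at h3
    rw [hc, MvPolynomial.eval_C, if_pos trivial, mul_one] at h3
    rwa [h3]
  have h4 : (Polynomial.map (MvPolynomial.eval z) (MvPolynomial.finSuccEquiv ℂ m p)).coeff (m + 1) ≠ 0 := by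
    rw [Polynomial.coeff_map, hc, MvPolynomial.eval_C]; exact hcne
  have h5 := Polynomial.le_degree_of_ne_zero h4
  refine lt_of_lt_of_le ?_ h5
  exact_mod_cast Nat.succ_pos m

lemma vw_stab_step {m : ℕ} (p : MvPolynomial (Fin (m + 1)) ℂ) (hp : p.IsHomogeneous (m + 1))
    (hs : VStab p) : VStab ((MvPolynomial.finSuccEquiv ℂ m p).coeff 1) := by
  intro z hz hz' h0
  set R := Polynomial.map (MvPolynomial.eval z) (MvPolynomial.finSuccEquiv ℂ m p) with hR
  have hdeg : 0 < R.degree := vw_deg p hp hs z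
  have h1 : R.derivative.eval 0 = 0 := by
    rw [← coeff_zero_eq_eval_zero, coeff_derivative, hR, Polynomial.coeff_map]; simp [h0]
  have hR0 : R ≠ 0 := by intro h; rw [h] at hdeg; simp at hdeg
  have hR1 : R.derivative ≠ 0 := by
    intro h
    have := Polynomial.derivative_eq_zero.1 h
    rw [Polynomial.natDegree_eq_zero_iff_degree_le_zero] at this
    exact absurd hdeg (not_lt.2 this)
  have h2 : (0 : ℂ) ∈ R.derivative.rootSet ℂ := by
    rw [mem_rootSet]; exact ⟨hR1, by simpa using h1⟩
  have h3 := Polynomial.rootSet_derivative_subset_convexHull_rootSet hdeg h2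
  have h4 : R.rootSet ℂ ⊆ {w : ℂ | w.re < 0} := by
    intro w hw
    rw [mem_rootSet] at hw
    by_contra hneg
    simp only [Set.mem_ofPred_eq, not_lt] at hneg
    have h5 : R.eval w = 0 := by simpa using hw.2
    rw [hR, ← MvPolynomial.eval_eq_eval_mv_eval'] at h5
    refine hs _ ?_ ?_ h5
    · intro i; refine Fin.cases ?_ (fun i => ?_) i
      · simpa using hneg
      · simpa using hz i
    · obtain ⟨i, hi⟩ := hz'
      exact ⟨i.succ, by simpa using hi⟩
  have h6 : Convex ℝ {w : ℂ | w.re < 0} := convex_halfSpace_re_lt 0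
  have h7 := convexHull_min h4 h6 h3
  simp at h7

lemma vw_rot (r : ℂ) (h : r ∉ {r : ℂ | ∃ ρ : ℝ, 0 < ρ ∧ r = -(ρ : ℂ)}) (h0 : r ≠ 0) :
    ∃ c : ℂ, 0 < c.re ∧ 0 ≤ (c * r).re := by
  by_cases hre : 0 ≤ r.re
  · exact ⟨1, by simp, by simpa using hre⟩
  push Not at hre
  have him : r.im ≠ 0 := by
    intro him
    apply h
    refine ⟨-r.re, by linarith, ?_⟩
    apply Complex.ext <;> simp [him]
  refine ⟨⟨1, r.re / r.im⟩, by simp, ?_⟩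
  simp [Complex.mul_re, div_mul_cancel₀ _ him]

lemma vw_main (m : ℕ) : ∀ (p : MvPolynomial (Fin m) ℂ) (κ : ℝ), p.IsHomogeneous m → VStab p →
    (∀ x : Fin m → ℝ, (∀ i, 0 < x i) → κ * ∏ i, x i ≤ ‖MvPolynomial.eval (fun i => (x i : ℂ)) p‖) →
    κ * Real.exp (-m) ≤ ‖MvPolynomial.coeff (Finsupp.equivFunOnFinite.symm fun _ => 1) p‖ := by
  induction m with
  | zero =>
    intro p κ _ _ hc
    have h := hc (fun _ => 1) (fun i => i.elim0)
    rw [MvPolynomial.eq_C_of_isEmpty p] at h ⊢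
    simp at h ⊢
    have e : (Finsupp.equivFunOnFinite.symm fun _ : Fin 0 => 1) = (0 : Fin 0 →₀ ℕ) := by
      ext i; exact i.elim0
    simpa [e] using h
  | succ m ih =>
    intro p κ hp hs hc
    have key := ih ((MvPolynomial.finSuccEquiv ℂ m p).coeff 1) (κ * Real.exp (-1))
      (hp.finSuccEquiv_coeff_isHomogeneous 1 m (add_comm _ _)) (vw_stab_step p hp hs) ?_
    · rw [MvPolynomial.finSuccEquiv_coeff_coeff] at key
      have e : (Finsupp.cons 1 (Finsupp.equivFunOnFinite.symm fun _ : Fin m => 1) : Fin (m + 1) →₀ ℕ)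
          = Finsupp.equivFunOnFinite.symm fun _ => 1 := by
        ext i; refine Fin.cases ?_ (fun i => ?_) i <;> simp
      rw [e, mul_assoc, ← Real.exp_add] at key
      convert key using 3
      push_cast; ring
    · intro x hx
      set z : Fin m → ℂ := fun i => (x i : ℂ) with hz
      set R := Polynomial.map (MvPolynomial.eval z) (MvPolynomial.finSuccEquiv ℂ m p) with hR
      have hdeg : 0 < R.degree := vw_deg p hp hs z
      have hR0 : R ≠ 0 := by intro h; rw [h] at hdeg; simp at hdeg
      have hev : ∀ t : ℂ, R.eval t = MvPolynomial.eval (Fin.cons t z : Fin (m + 1) → ℂ) p := fun t => by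
        rw [hR, ← MvPolynomial.eval_eq_eval_mv_eval']
      rcases Nat.eq_zero_or_pos m with hm | hm
      · subst hm
        have h1 := hc (fun _ => 1) (fun _ => one_pos)
        set a := MvPolynomial.eval (Fin.cons 1 z : Fin (0 + 1) → ℂ) p with ha
        have hRa : R = Polynomial.C a * Polynomial.X := by
          apply Polynomial.funext
          intro t
          rw [hev]
          have h2 := vw_hom_eval p hp t (Fin.cons 1 z)
          have h3 : (fun i => t * (Fin.cons 1 z : Fin (0 + 1) → ℂ) i)
              = (Fin.cons t z : Fin (0 + 1) → ℂ) := by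
            funext i; refine Fin.cases ?_ (fun i => i.elim0) i; simp
          rw [h3, ← ha] at h2
          rw [h2, Polynomial.eval_mul, Polynomial.eval_C, Polynomial.eval_X, zero_add, pow_one, mul_comm]
        have h4 : MvPolynomial.eval z ((MvPolynomial.finSuccEquiv ℂ 0 p).coeff 1) = a := by
          have := congrArg (fun q => Polynomial.coeff q 1) hRa
          simp only [hR, Polynomial.coeff_map] at this
          rw [this]; simp
        have h5 : (fun i : Fin (0 + 1) => (((fun _ => 1 : Fin (0 + 1) → ℝ) i : ℝ) : ℂ))
            = (Fin.cons 1 z : Fin (0 + 1) → ℂ) := by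
          funext i; refine Fin.cases ?_ (fun i => i.elim0) i; simp
        rw [h4]
        rw [h5, ← ha] at h1
        simp at h1 ⊢
        rcases le_or_gt κ 0 with hk | hk
        · exact (mul_nonpos_of_nonpos_of_nonneg hk (Real.exp_pos _).le).trans (norm_nonneg _)
        · refine le_trans ?_ h1
          have : Real.exp (-1) ≤ 1 := by simp
          nlinarith
      have := vw_uni R hdeg ?_ (κ * ∏ i, x i) ?_
      · rw [hR, Polynomial.coeff_map] at this
        calc κ * Real.exp (-1) * ∏ i, x i = (κ * ∏ i, x i) * Real.exp (-1) := by ring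
          _ ≤ _ := this
      · intro r hr
        rw [mem_roots hR0, IsRoot.def, hev] at hr
        · by_contra hcon
          obtain ⟨c, hc1, hc2⟩ : ∃ c : ℂ, 0 < c.re ∧ 0 ≤ (c * r).re := by
            by_cases hr0 : r = 0
            · exact ⟨1, by simp, by simp [hr0]⟩
            · exact vw_rot r hcon hr0
          have h1 := vw_hom_eval p hp c (Fin.cons r z)
          rw [hr, mul_zero] at h1
          refine hs _ ?_ ?_ h1
          · intro i; refine Fin.cases ?_ (fun i => ?_) i
            · simpa using hc2
            · simp [hz]; exact mul_nonneg hc1.le (hx i).le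
          · refine ⟨Fin.succ ⟨0, hm⟩, ?_⟩
            rw [Fin.cons_succ]
            simp only [hz, Complex.re_mul_ofReal]; exact mul_pos hc1 (hx _)
      · intro t ht
        rw [hev]
        have := hc (Fin.cons t x) (by intro i; refine Fin.cases ?_ (fun i => ?_) i <;> simp [ht, hx])
        rw [Fin.prod_univ_succ] at this
        simp only [Fin.cons_zero, Fin.cons_succ] at this
        calc κ * (∏ i, x i) * t = κ * (t * ∏ i, x i) := by ring
          _ ≤ _ := this
          _ = _ := by
            congr 2
            congr 1
            funext i; refine Fin.cases ?_ (fun i => ?_) i <;> simp [hz]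
end VdW

section LowerB

lemma vw_coeff {n : ℕ} (a : Fin n → Fin n → ℝ) (ha : ∀ i j, 0 ≤ a i j) :
    ‖MvPolynomial.coeff (Finsupp.equivFunOnFinite.symm fun _ => 1)
      (∏ i, ∑ j, MvPolynomial.C (a i j : ℂ) * MvPolynomial.X j : MvPolynomial (Fin n) ℂ)‖
    ≤ ∑ σ : Equiv.Perm (Fin n), ∏ i, a i (σ i) := by
  rw [Finset.prod_univ_sum, MvPolynomial.coeff_sum]
  refine (norm_sum_le _ _).trans ?_
  have hterm : ∀ f : Fin n → Fin n,
      ‖MvPolynomial.coeff (Finsupp.equivFunOnFinite.symm fun _ => 1)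
        (∏ i, (MvPolynomial.C (a i (f i) : ℂ) * MvPolynomial.X (f i)) : MvPolynomial (Fin n) ℂ)‖
      ≤ if Function.Bijective f then ∏ i, a i (f i) else 0 := by
    intro f
    have h1 : (∏ i, (MvPolynomial.C (a i (f i) : ℂ) * MvPolynomial.X (f i)) : MvPolynomial (Fin n) ℂ)
        = MvPolynomial.monomial (∑ i, Finsupp.single (f i) 1) (∏ i, (a i (f i) : ℂ)) := by
      rw [MvPolynomial.monomial_sum_index, Finset.prod_mul_distrib]
      simp [MvPolynomial.X]
    rw [h1, MvPolynomial.coeff_monomial]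
    split_ifs with h2 h3 h3
    · rw [norm_prod]
      apply le_of_eq
      refine Finset.prod_congr rfl fun i _ => ?_
      rw [Complex.norm_real, Real.norm_of_nonneg (ha _ _)]
    · exfalso
      apply h3
      have hs : Function.Surjective f := by
        intro j
        have h4 := DFunLike.congr_fun h2 j
        simp only [Finsupp.coe_finsetSum, Finset.sum_apply, Finsupp.equivFunOnFinite_symm_apply_apply] at h4
        by_contra hne
        push Not at hne
        rw [Finset.sum_eq_zero] at h4
        · simp at h4
        · intro i _
          rw [Finsupp.single_eq_of_ne]
          exact fun h => hne i h.symm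
      exact ⟨Finite.injective_iff_surjective.2 hs, hs⟩
    · simp; exact Finset.prod_nonneg fun i _ => ha _ _
    · simp
  calc _ ≤ ∑ f : Fin n → Fin n, if Function.Bijective f then ∏ i, a i (f i) else 0 := by
        rw [Fintype.piFinset_univ]
        exact Finset.sum_le_sum fun f _ => hterm f
    _ = ∑ f ∈ univ.filter (fun f : Fin n → Fin n => Function.Bijective f), ∏ i, a i (f i) := by
        rw [Finset.sum_filter]
    _ ≤ _ := by
        apply le_of_eq
        refine Finset.sum_bij' (fun f hf => Equiv.ofBijective f (Finset.mem_filter.1 hf).2)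
          (fun σ _ => (σ : Fin n → Fin n)) ?_ ?_ ?_ ?_ ?_
        · intros; simp
        · intro σ _; exact Finset.mem_filter.2 ⟨Finset.mem_univ _, σ.bijective⟩
        · intros; rfl
        · intro σ _; ext; simp
        · intros; simp

lemma vw_pos {n : ℕ} (a : Fin n → Fin n → ℝ) (ha : ∀ i j, 0 < a i j)
    (hr : ∀ i, ∑ j, a i j = 1) (hc : ∀ j, ∑ i, a i j = 1) :
    Real.exp (-n) ≤ ∑ σ : Equiv.Perm (Fin n), ∏ i, a i (σ i) := by
  refine le_trans ?_ (vw_coeff a (fun i j => (ha i j).le))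
  have := vw_main n (∏ i, ∑ j, MvPolynomial.C (a i j : ℂ) * MvPolynomial.X j) 1 ?_ ?_ ?_
  · simpa using this
  · have := MvPolynomial.IsHomogeneous.prod (univ : Finset (Fin n))
      (fun i => ∑ j, MvPolynomial.C (a i j : ℂ) * MvPolynomial.X j) (fun _ => 1) ?_
    · simpa using this
    · intro i _
      apply MvPolynomial.IsHomogeneous.sum
      intro j _
      exact MvPolynomial.isHomogeneous_C_mul_X _ _
  · rintro z hz ⟨i0, hi0⟩
    rw [map_prod, Finset.prod_ne_zero_iff]
    intro i _ h
    have h2 := congrArg Complex.re h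
    simp at h2
    have : 0 < ∑ j, a i j * (z j).re :=
      Finset.sum_pos' (fun j _ => mul_nonneg (ha i j).le (hz j)) ⟨i0, Finset.mem_univ _, mul_pos (ha _ _) hi0⟩
    linarith
  · intro x hx
    rw [map_prod, norm_prod, one_mul]
    have h1 : ∀ i, ∏ j, x j ^ a i j ≤
        ‖MvPolynomial.eval (fun i => (x i : ℂ)) (∑ j, MvPolynomial.C (a i j : ℂ) * MvPolynomial.X j)‖ := by
      intro i
      have h2 : MvPolynomial.eval (fun i => (x i : ℂ)) (∑ j, MvPolynomial.C (a i j : ℂ) * MvPolynomial.X j)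
          = ((∑ j, a i j * x j : ℝ) : ℂ) := by simp
      rw [h2, Complex.norm_real, Real.norm_of_nonneg (Finset.sum_nonneg fun j _ => mul_nonneg (ha i j).le (hx j).le)]
      exact Real.geom_mean_le_arith_mean_weighted _ _ _ (fun j _ => (ha i j).le) (hr i) (fun j _ => (hx j).le)
    calc ∏ j, x j = ∏ j, ∏ i, x j ^ a i j := by
          refine Finset.prod_congr rfl fun j _ => ?_
          rw [← Real.rpow_sum_of_pos (hx j), hc, Real.rpow_one]
      _ = ∏ i, ∏ j, x j ^ a i j := Finset.prod_comm
      _ ≤ _ := Finset.prod_le_prod (fun i _ => Finset.prod_nonneg fun j _ => Real.rpow_nonneg (hx j).le _) (fun i _ => h1 i)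

lemma vw_nonneg {n : ℕ} (a : Fin n → Fin n → ℝ) (ha : ∀ i j, 0 ≤ a i j)
    (hr : ∀ i, ∑ j, a i j = 1) (hc : ∀ j, ∑ i, a i j = 1) :
    Real.exp (-n) ≤ ∑ σ : Equiv.Perm (Fin n), ∏ i, a i (σ i) := by
  rcases Nat.eq_zero_or_pos n with hn | hn
  · subst hn; simp
  have hn' : (0 : ℝ) < n := by exact_mod_cast hn
  let F : ℝ → ℝ := fun ε => ∑ σ : Equiv.Perm (Fin n), ∏ i, ((1 - ε) * a i (σ i) + ε / n)
  have hF : Continuous F := by fun_prop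
  have h0 : F 0 = ∑ σ : Equiv.Perm (Fin n), ∏ i, a i (σ i) := by simp [F]
  rw [← h0]
  refine ge_of_tendsto ((hF.tendsto 0).mono_left nhdsWithin_le_nhds : Filter.Tendsto F (nhdsWithin 0 (Set.Ioi 0)) _) ?_
  have : ∀ᶠ ε in nhdsWithin (0 : ℝ) (Set.Ioi 0), ε ∈ Set.Ioo (0 : ℝ) 1 := Ioo_mem_nhdsGT one_pos
  filter_upwards [this] with ε hε
  apply vw_pos (fun i j => (1 - ε) * a i j + ε / n)
  · intro i j
    have := mul_nonneg (sub_nonneg.2 hε.2.le) (ha i j)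
    have := div_pos hε.1 hn'
    linarith
  · intro i
    rw [Finset.sum_add_distrib, ← Finset.mul_sum, hr]
    simp; field_simp; ring
  · intro i
    rw [Finset.sum_add_distrib, ← Finset.mul_sum, hc]
    simp; field_simp; ring

lemma vw_count {n : ℕ} (P : Fin n → Fin n → Prop) (k : ℕ) (hk : 0 < k)
    (hr : ∀ i, (univ.filter fun j => P i j).card = k) (hc : ∀ j, (univ.filter fun i => P i j).card = k) :
    ((k : ℝ) * Real.exp (-1)) ^ n ≤ ((univ.filter fun σ : Equiv.Perm (Fin n) => ∀ i, P i (σ i)).card : ℝ) := by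
  have hk' : (0 : ℝ) < k := by exact_mod_cast hk
  have h := vw_nonneg (fun i j => if P i j then (k : ℝ)⁻¹ else 0) ?_ ?_ ?_
  · have h2 : ∀ σ : Equiv.Perm (Fin n), ∏ i, (if P i (σ i) then (k : ℝ)⁻¹ else 0)
        = if ∀ i, P i (σ i) then ((k : ℝ)⁻¹) ^ n else 0 := by
      intro σ
      rw [Finset.prod_ite_zero]
      simp
    simp only [h2] at h
    rw [← Finset.sum_filter, Finset.sum_const, nsmul_eq_mul, inv_pow, ← div_eq_mul_inv, le_div_iff₀ (by positivity)] at h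
    calc _ = Real.exp (-n) * (k : ℝ) ^ n := by
          rw [mul_pow, ← Real.exp_nat_mul]; ring_nf
      _ ≤ _ := h
  · intro i j; split_ifs <;> positivity
  · intro i
    rw [← Finset.sum_filter, Finset.sum_const, hr, nsmul_eq_mul, mul_inv_cancel₀ hk'.ne']
  · intro i
    rw [← Finset.sum_filter, Finset.sum_const, hc, nsmul_eq_mul, mul_inv_cancel₀ hk'.ne']

def IsRect {m n : ℕ} (L : Fin m → Equiv.Perm (Fin n)) : Prop :=
  ∀ i j : Fin m, i ≠ j → ∀ x : Fin n, L i x ≠ L j x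

lemma rect_step {m n : ℕ} (hm : m < n) :
    ((univ.filter fun L : Fin m → Equiv.Perm (Fin n) => IsRect L).card : ℝ) *
      (((n - m : ℕ) : ℝ) * Real.exp (-1)) ^ n ≤
    ((univ.filter fun L : Fin (m + 1) → Equiv.Perm (Fin n) => IsRect L).card : ℝ) := by
  have h1 : ∀ L : Fin m → Equiv.Perm (Fin n), IsRect L →
      (((n - m : ℕ) : ℝ) * Real.exp (-1)) ^ n ≤
      ((univ.filter fun σ : Equiv.Perm (Fin n) => ∀ x, ∀ i, L i x ≠ σ x).card : ℝ) := by
    intro L hL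
    refine le_trans (vw_count (fun x y => ∀ i, L i x ≠ y) (n - m) (by omega) ?_ ?_) (le_of_eq (by congr!))
    · intro x
      have : (univ.filter fun y => ∀ i, L i x ≠ y) = (univ.image fun i => L i x)ᶜ := by
        ext y; simp
      refine Eq.trans (congrArg Finset.card (Eq.trans (by congr!) this)) ?_
      rw [Finset.card_compl, Finset.card_image_of_injective]
      · simp
      · intro i j hij; by_contra hne; exact hL i j hne x hij
    · intro y
      have : (univ.filter fun x => ∀ i, L i x ≠ y) = (univ.image fun i => (L i).symm y)ᶜ := by
        ext x; simp [Equiv.symm_apply_eq]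
        exact forall_congr' fun i => not_congr eq_comm
      refine Eq.trans (congrArg Finset.card (Eq.trans (by congr!) this)) ?_
      rw [Finset.card_compl, Finset.card_image_of_injective]
      · simp
      · intro i j hij; by_contra hne
        simp only at hij
        apply hL i j hne ((L i).symm y)
        rw [Equiv.apply_symm_apply, hij, Equiv.apply_symm_apply]
  calc _ = ∑ L ∈ univ.filter (fun L : Fin m → Equiv.Perm (Fin n) => IsRect L),
        (((n - m : ℕ) : ℝ) * Real.exp (-1)) ^ n := by rw [Finset.sum_const, nsmul_eq_mul]
    _ ≤ ∑ L ∈ univ.filter (fun L : Fin m → Equiv.Perm (Fin n) => IsRect L),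
        ((univ.filter fun σ : Equiv.Perm (Fin n) => ∀ x, ∀ i, L i x ≠ σ x).card : ℝ) :=
        Finset.sum_le_sum fun L hL => h1 L (Finset.mem_filter.1 hL).2
    _ = (((univ.filter fun L : Fin m → Equiv.Perm (Fin n) => IsRect L).sigma
          fun L => univ.filter fun σ : Equiv.Perm (Fin n) => ∀ x, ∀ i, L i x ≠ σ x).card : ℝ) := by
        rw [Finset.card_sigma]; push_cast; rfl
    _ ≤ _ := by
        norm_cast
        apply Finset.card_le_card_of_injOn
          (fun q => (Fin.cons q.2 q.1 : Fin (m + 1) → Equiv.Perm (Fin n)))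
        · rintro ⟨L, σ⟩ h
          simp at h
          obtain ⟨hL, hσ⟩ := h
          simp
          intro i j
          refine Fin.cases ?_ (fun i => ?_) i <;> refine Fin.cases ?_ (fun j => ?_) j
          · simp
          · intro _ x; simp; exact fun h => hσ x j h.symm
          · intro _ x; simp; exact hσ x i
          · intro hne x; simp; exact hL i j (fun h => hne (by rw [h])) x
        · rintro ⟨L, σ⟩ _ ⟨L', σ'⟩ _ h
          simp [Fin.cons_inj] at h
          simp [h.1, h.2]

lemma rect_lower {n : ℕ} : ∀ m ≤ n, ∏ k ∈ Finset.range m, (((n - k : ℕ) : ℝ) * Real.exp (-1)) ^ n ≤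
    ((univ.filter fun L : Fin m → Equiv.Perm (Fin n) => IsRect L).card : ℝ) := by
  intro m
  induction m with
  | zero =>
    intro _
    have : (univ.filter fun L : Fin 0 → Equiv.Perm (Fin n) => IsRect L) = univ := by
      ext L; simp only [mem_filter, mem_univ, true_and, iff_true]; intro i; exact i.elim0
    rw [this]; simp
  | succ m ih =>
    intro hm
    rw [Finset.prod_range_succ]
    refine le_trans ?_ (rect_step (by omega))
    gcongr
    exact ih (by omega)

lemma latin_lower (n : ℕ) (hn : 0 < n) :
    Real.exp ((n : ℝ) ^ 2 * (Real.log n - 2)) ≤ (Fintype.card (LatinSquare n) : ℝ) := by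
  have h1 := rect_lower (n := n) n le_rfl
  have h2 : ((univ.filter fun L : Fin n → Equiv.Perm (Fin n) => IsRect L).card : ℝ)
      = (Fintype.card (LatinSquare n) : ℝ) := by
    rw [Fintype.card_subtype]; rfl
  rw [← h2]
  refine le_trans ?_ h1
  rw [Finset.prod_pow, Finset.prod_mul_distrib, Finset.prod_const, Finset.card_range]
  have h3 : ∏ k ∈ Finset.range n, ((n - k : ℕ) : ℝ) = (n.factorial : ℝ) := by
    rw [← Nat.descFactorial_self, Nat.descFactorial_eq_prod_range]; push_cast; rfl
  rw [h3]
  have hn' : (0 : ℝ) < n := by exact_mod_cast hn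
  have h4 : (n : ℝ) ^ n * Real.exp (-n) ≤ n.factorial := by
    have := Real.pow_div_factorial_le_exp (x := n) hn'.le n
    rw [div_le_iff₀ (by positivity)] at this
    rw [Real.exp_neg, ← div_eq_mul_inv, div_le_iff₀ (Real.exp_pos _)]; linarith
  have h5 : Real.exp ((n : ℝ) ^ 2 * (Real.log n - 2)) = ((n : ℝ) ^ n * Real.exp (-n) * Real.exp (-1) ^ n) ^ n := by
    have : (n : ℝ) ^ n = Real.exp (n * Real.log n) := by
      rw [Real.exp_nat_mul, Real.exp_log hn']
    rw [this, ← Real.exp_nat_mul, ← Real.exp_add, ← Real.exp_add, ← Real.exp_nat_mul]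
    congr 1; ring
  rw [h5]
  gcongr
end LowerB

section UpperC

def krS {I K : Type*} (r : I → ℕ) (S : Finset (I → K)) (t : ℕ) (x : I → K) : Finset (I → K) :=
  S.filter fun y => ∀ c, r c < t → y c = x c

def krW {I K : Type*} [DecidableEq K] (r : I → ℕ) (S : Finset (I → K)) (w : I → K → ℝ) (c : I) (x : I → K) : ℝ :=
  ∑ k ∈ (krS r S (r c) x).image (fun y => y c), w c k

lemma mem_krS {I K : Type*} {r : I → ℕ} {S : Finset (I → K)} {t : ℕ} {x y : I → K} :
    y ∈ krS r S t x ↔ y ∈ S ∧ ∀ c, r c < t → y c = x c := by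
  simp [krS]

lemma krS_congr {I K : Type*} (r : I → ℕ) (S : Finset (I → K)) (t : ℕ) (x x' : I → K)
    (h : x' ∈ krS r S t x) : krS r S t x' = krS r S t x := by
  ext y
  rw [mem_krS] at h
  simp only [mem_krS]
  constructor
  · rintro ⟨h1, h2⟩; exact ⟨h1, fun c hc => (h2 c hc).trans (h.2 c hc)⟩
  · rintro ⟨h1, h2⟩; exact ⟨h1, fun c hc => (h2 c hc).trans (h.2 c hc).symm⟩

lemma kraft {I K : Type*} [Fintype I] [DecidableEq K] (r : I → ℕ) (hr : Function.Injective r)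
    (S : Finset (I → K)) (w : I → K → ℝ) (hw : ∀ c k, 0 < w c k) :
    ∑ x ∈ S, ∏ c, w c (x c) / krW r S w c x ≤ 1 := by
  obtain ⟨T, hT⟩ : ∃ T, ∀ c, r c < T :=
    ⟨univ.sup r + 1, fun c => Nat.lt_succ_of_le (Finset.le_sup (Finset.mem_univ c))⟩
  have key : ∀ u t, t + u = T → ∀ x0 ∈ S,
      ∑ x ∈ krS r S t x0, ∏ c ∈ univ.filter (fun c => t ≤ r c), w c (x c) / krW r S w c x ≤ 1 := by
    intro u
    induction u with
    | zero =>
      intro t ht x0 hx0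
      have h1 : krS r S t x0 = {x0} := by
        ext y; rw [mem_krS, Finset.mem_singleton]
        constructor
        · rintro ⟨_, h⟩; funext c; exact h c (by have := hT c; omega)
        · rintro rfl; exact ⟨hx0, fun _ _ => rfl⟩
      have h2 : (univ.filter fun c => t ≤ r c) = ∅ := by
        ext c; simp; have := hT c; omega
      rw [h1, h2]; simp
    | succ u ih =>
      intro t ht x0 hx0
      by_cases hc : ∃ c0, r c0 = t
      · obtain ⟨c0, hc0⟩ := hc
        have h2 : (univ.filter fun c => t ≤ r c) = insert c0 (univ.filter fun c => t + 1 ≤ r c) := by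
          ext c; simp
          constructor
          · intro h
            rcases eq_or_lt_of_le h with h | h
            · left; exact hr (by omega)
            · right; omega
          · rintro (rfl | h) <;> omega
        have h3 : c0 ∉ (univ.filter fun c => t + 1 ≤ r c) := by simp; omega
        simp only [h2, Finset.prod_insert h3]
        have hmap : ∀ x ∈ krS r S t x0, x c0 ∈ (krS r S t x0).image (fun y => y c0) :=
          fun x hx => Finset.mem_image_of_mem _ hx
        rw [← Finset.sum_fiberwise_of_maps_to hmap]
        have hWeq : ∀ x ∈ krS r S t x0, krW r S w c0 x = krW r S w c0 x0 := by
          intro x hx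
          unfold krW
          rw [hc0, krS_congr r S t x0 x hx]
        have hWpos : 0 < krW r S w c0 x0 := by
          unfold krW
          refine Finset.sum_pos (fun k _ => hw c0 k) ⟨x0 c0, ?_⟩
          apply Finset.mem_image_of_mem (fun y : I → K => y c0)
          exact mem_krS.2 ⟨hx0, fun _ _ => rfl⟩
        calc _ ≤ ∑ k ∈ (krS r S t x0).image (fun y => y c0), w c0 k / krW r S w c0 x0 := by
              refine Finset.sum_le_sum fun k hk => ?_
              obtain ⟨xk, hxk, hxk2⟩ := Finset.mem_image.1 hk
              have h5 : (krS r S t x0).filter (fun x => x c0 = k) = krS r S (t + 1) xk := by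
                ext y
                rw [mem_krS] at hxk
                simp only [Finset.mem_filter, mem_krS]
                constructor
                · rintro ⟨⟨a, b⟩, c⟩
                  refine ⟨a, fun c' hc' => ?_⟩
                  rcases Nat.lt_succ_iff_lt_or_eq.1 hc' with h | h
                  · rw [b c' h, hxk.2 c' h]
                  · have : c' = c0 := hr (by omega)
                    subst this; rw [c, hxk2]
                · rintro ⟨a, b⟩
                  refine ⟨⟨a, fun c' hc' => ?_⟩, ?_⟩
                  · rw [b c' (by omega), hxk.2 c' hc']
                  · rw [b c0 (by omega), hxk2]
              calc _ = ∑ x ∈ (krS r S t x0).filter (fun x => x c0 = k), w c0 k / krW r S w c0 x0 *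
                    ∏ c ∈ univ.filter (fun c => t + 1 ≤ r c), w c (x c) / krW r S w c x := by
                    refine Finset.sum_congr rfl fun x hx => ?_
                    rw [Finset.mem_filter] at hx
                    rw [hx.2, hWeq x hx.1]
                _ = w c0 k / krW r S w c0 x0 * ∑ x ∈ krS r S (t + 1) xk,
                    ∏ c ∈ univ.filter (fun c => t + 1 ≤ r c), w c (x c) / krW r S w c x := by
                    rw [← Finset.mul_sum, h5]
                _ ≤ w c0 k / krW r S w c0 x0 * 1 := by
                    refine mul_le_mul_of_nonneg_left ?_ (div_nonneg (hw _ _).le hWpos.le)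
                    exact ih (t + 1) (by omega) xk (mem_krS.1 hxk).1
                _ = _ := mul_one _
          _ = 1 := by
              rw [← Finset.sum_div]
              have : krW r S w c0 x0 = ∑ k ∈ (krS r S t x0).image (fun y => y c0), w c0 k := by
                unfold krW; rw [hc0]
              rw [← this, div_self hWpos.ne']
      · push Not at hc
        have h1 : krS r S t x0 = krS r S (t + 1) x0 := by
          ext y; simp only [mem_krS]
          refine and_congr_right fun _ => forall_congr' fun c => ?_
          have := hc c
          constructor <;> intro h h' <;> apply h <;> omega
        have h2 : (univ.filter fun c => t ≤ r c) = (univ.filter fun c => t + 1 ≤ r c) := by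
          ext c; simp; have := hc c; omega
        rw [h1, h2]
        exact ih (t + 1) (by omega) x0 hx0
  rcases S.eq_empty_or_nonempty with h | ⟨x0, hx0⟩
  · subst h; simp
  · have := key T 0 (by omega) x0 hx0
    have h1 : krS r S 0 x0 = S := by ext; simp [krS]
    rw [h1] at this
    simpa using this

lemma perm_swap_avg {n : ℕ} (i R : Fin n) (hR : R ≠ i) (f : Fin n → ℝ) (hf : ∀ p, 0 ≤ f p) :
    ∑ σ : Equiv.Perm (Fin n), (if σ i ≤ σ R then f (σ i) else 0) ≤
    ∑ σ : Equiv.Perm (Fin n), (((n : ℝ) - (σ i : ℕ)) / n) * f (σ i) := by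
  have hn2 : 2 ≤ n := by
    have h1 := R.2; have h2 := i.2
    have : (R : ℕ) ≠ i := fun h => hR (Fin.ext h)
    omega
  set A : Fin n → ℝ := fun R' => ∑ σ : Equiv.Perm (Fin n), (if σ i ≤ σ R' then f (σ i) else 0) with hA
  have hsym : ∀ R', R' ≠ i → A R' = A R := by
    intro R' hR'
    simp only [hA]
    refine Fintype.sum_equiv (Equiv.mulRight (Equiv.swap R R')) _ _ fun σ => ?_
    simp [Equiv.Perm.mul_apply, Equiv.swap_apply_of_ne_of_ne hR.symm hR'.symm]
  have hAi : A i = ∑ σ : Equiv.Perm (Fin n), f (σ i) := by simp [hA]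
  have htot : ∑ R', A R' = ∑ σ : Equiv.Perm (Fin n), ((n : ℝ) - (σ i : ℕ)) * f (σ i) := by
    simp only [hA]
    rw [Finset.sum_comm]
    refine Finset.sum_congr rfl fun σ _ => ?_
    rw [← Finset.sum_filter, Finset.sum_const, nsmul_eq_mul]
    congr 1
    have : (univ.filter fun R' => σ i ≤ σ R').card = (Finset.Ici (σ i)).card := by
      refine Finset.card_bij (fun a _ => σ a) ?_ ?_ ?_
      · intro a ha; simpa using ha
      · intro a _ b _ h; exact σ.injective h
      · intro b hb; exact ⟨σ.symm b, by simpa using hb, by simp⟩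
    rw [this, Fin.card_Ici, Nat.cast_sub (σ i).2.le]
  have htot2 : ∑ R', A R' = ((n : ℝ) - 1) * A R + A i := by
    rw [← Finset.sum_erase_add _ _ (Finset.mem_univ i)]
    congr 1
    rw [Finset.sum_congr rfl (fun R' hR' => hsym R' (Finset.ne_of_mem_erase hR')), Finset.sum_const,
      Finset.card_erase_of_mem (Finset.mem_univ _), nsmul_eq_mul, Finset.card_univ, Fintype.card_fin,
      Nat.cast_sub (by omega)]
    simp
  have hn1 : (0 : ℝ) < (n : ℝ) - 1 := by
    have : (2 : ℝ) ≤ n := by exact_mod_cast hn2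
    linarith
  have h1 : ((n : ℝ) - 1) * A R = ∑ σ : Equiv.Perm (Fin n), ((n : ℝ) - 1 - (σ i : ℕ)) * f (σ i) := by
    have : ((n : ℝ) - 1) * A R = ∑ σ : Equiv.Perm (Fin n), ((n : ℝ) - (σ i : ℕ)) * f (σ i)
        - ∑ σ : Equiv.Perm (Fin n), f (σ i) := by rw [← htot, ← hAi, htot2]; ring
    rw [this, ← Finset.sum_sub_distrib]
    refine Finset.sum_congr rfl fun σ _ => by ring
  have h2 : A R ≤ ∑ σ : Equiv.Perm (Fin n), (((n : ℝ) - (σ i : ℕ)) / n) * f (σ i) := by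
    rw [← mul_le_mul_iff_right₀ hn1, h1, Finset.mul_sum]
    refine Finset.sum_le_sum fun σ _ => ?_
    rw [← mul_assoc]
    refine mul_le_mul_of_nonneg_right ?_ (hf _)
    have h3 : (0 : ℝ) ≤ (σ i : ℕ) := Nat.cast_nonneg _
    rw [← mul_div_assoc, le_div_iff₀ (by linarith)]
    nlinarith
  exact h2

lemma perm_avg1 {n : ℕ} (hn : 0 < n) (i : Fin n) (f : Fin n → ℝ) :
    ∑ σ : Equiv.Perm (Fin n), f (σ i) = (n.factorial : ℝ) / n * ∑ p, f p := by
  have h : ∀ j, ∑ σ : Equiv.Perm (Fin n), f (σ j) = ∑ σ : Equiv.Perm (Fin n), f (σ i) := by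
    intro j
    refine Fintype.sum_equiv (Equiv.mulRight (Equiv.swap i j)) _ _ fun σ => ?_
    simp [Equiv.Perm.mul_apply]
  have h2 : ∑ j, ∑ σ : Equiv.Perm (Fin n), f (σ j) = n.factorial * ∑ p, f p := by
    rw [Finset.sum_comm]
    have : ∀ σ : Equiv.Perm (Fin n), ∑ j, f (σ j) = ∑ p, f p := fun σ => Equiv.sum_comp σ f
    simp only [this]
    rw [Finset.sum_const, nsmul_eq_mul, Finset.card_univ, Fintype.card_perm, Fintype.card_fin]
  simp only [h] at h2
  rw [Finset.sum_const, nsmul_eq_mul, Finset.card_univ, Fintype.card_fin] at h2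
  have : (0 : ℝ) < n := by exact_mod_cast hn
  field_simp
  linarith

def colPerm {n : ℕ} (L : LatinSquare n) (j : Fin n) : Equiv.Perm (Fin n) :=
  Equiv.ofBijective (fun i => L.1 i j) (by
    have h : Function.Injective (fun i => L.1 i j) := by
      intro a b hab
      by_contra hne
      exact L.2 a b hne j hab
    exact ⟨h, Finite.injective_iff_surjective.1 h⟩)

lemma colPerm_apply {n : ℕ} (L : LatinSquare n) (i j : Fin n) : colPerm L j i = L.1 i j := rfl

lemma colPerm_symm {n : ℕ} (L : LatinSquare n) (j k : Fin n) : L.1 ((colPerm L j).symm k) j = k :=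
  (colPerm L j).apply_symm_apply k

def lsU {n : ℕ} (w : Fin n → Fin n → Fin n → ℝ) (σ τ : Equiv.Perm (Fin n)) (L : LatinSquare n)
    (i j : Fin n) : ℝ :=
  ∑ k, if σ i ≤ σ ((colPerm L j).symm k) then (if τ j ≤ τ ((L.1 i).symm k) then w i j k else 0) else 0

lemma lsU_pos {n : ℕ} (w : Fin n → Fin n → Fin n → ℝ) (hw : ∀ i j k, 0 < w i j k)
    (σ τ : Equiv.Perm (Fin n)) (L : LatinSquare n) (i j : Fin n) : 0 < lsU w σ τ L i j := by
  unfold lsU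
  refine Finset.sum_pos' (fun k _ => ?_) ⟨L.1 i j, Finset.mem_univ _, ?_⟩
  · split_ifs
    · exact (hw i j k).le
    · exact le_rfl
    · exact le_rfl
  · have h1 : (colPerm L j).symm (L.1 i j) = i := by
      rw [← colPerm_apply, Equiv.symm_apply_apply]
    rw [h1]; simp [hw]

lemma ls_kraft {n : ℕ} (w : Fin n → Fin n → Fin n → ℝ) (hw : ∀ i j k, 0 < w i j k)
    (σ τ : Equiv.Perm (Fin n)) :
    ∑ L : LatinSquare n, ∏ c : Fin n × Fin n, w c.1 c.2 (L.1 c.1 c.2) / lsU w σ τ L c.1 c.2 ≤ 1 := by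
  let r : Fin n × Fin n → ℕ := fun c => n * (σ c.1 : ℕ) + (τ c.2 : ℕ)
  have hr : Function.Injective r := by
    rintro ⟨a, b⟩ ⟨a', b'⟩ h
    simp only [r] at h
    have h1 := (τ b).2
    have h2 := (τ b').2
    have h3 : (σ a : ℕ) = σ a' := by
      have e1 : (n * (σ a : ℕ) + (τ b : ℕ)) / n = σ a := by
        rw [Nat.mul_add_div (by omega), Nat.div_eq_of_lt h1, add_zero]
      have e2 : (n * (σ a' : ℕ) + (τ b' : ℕ)) / n = σ a' := by
        rw [Nat.mul_add_div (by omega), Nat.div_eq_of_lt h2, add_zero]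
      rw [← e1, ← e2, h]
    have h4 : (τ b : ℕ) = τ b' := by rw [h3] at h; omega
    rw [σ.injective (Fin.ext h3), τ.injective (Fin.ext h4)]
  let e : LatinSquare n → (Fin n × Fin n → Fin n) := fun L c => L.1 c.1 c.2
  have he : Function.Injective e := by
    intro L L' h
    apply Subtype.ext
    funext i
    ext j
    exact congrArg Fin.val (congrFun h (i, j))
  have hk := kraft r hr (univ.image e) (fun c k => w c.1 c.2 k) (fun c k => hw _ _ _)
  rw [Finset.sum_image (fun a _ b _ h => he h)] at hk
  refine le_trans (Finset.sum_le_sum fun L _ => ?_) hk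
  refine Finset.prod_le_prod (fun c _ => div_nonneg (hw _ _ _).le (lsU_pos w hw _ _ _ _ _).le) ?_
  rintro ⟨i, j⟩ -
  have hWpos : 0 < krW r (univ.image e) (fun c k => w c.1 c.2 k) (i, j) (e L) := by
    unfold krW
    refine Finset.sum_pos (fun k _ => hw _ _ k) ⟨e L (i, j), ?_⟩
    apply Finset.mem_image_of_mem (fun y : Fin n × Fin n → Fin n => y (i, j))
    exact mem_krS.2 ⟨Finset.mem_image_of_mem _ (Finset.mem_univ _), fun _ _ => rfl⟩
  refine div_le_div_of_nonneg_left (hw _ _ _).le hWpos ?_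
  unfold krW lsU
  have hsub : ∀ k ∈ (krS r (univ.image e) (r (i, j)) (e L)).image (fun y => y (i, j)),
      σ i ≤ σ ((colPerm L j).symm k) ∧ τ j ≤ τ ((L.1 i).symm k) := by
    intro k hk
    obtain ⟨y, hy, hyk⟩ := Finset.mem_image.1 hk
    obtain ⟨hy1, hy2⟩ := mem_krS.1 hy
    obtain ⟨L', -, rfl⟩ := Finset.mem_image.1 hy1
    simp only [e] at hyk hy2
    constructor
    · by_contra hlt
      push Not at hlt
      set i' := (colPerm L j).symm k with hi'
      have h1 : L.1 i' j = k := colPerm_symm L j k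
      have h2 := hy2 (i', j) (by
        have : (σ i' : ℕ) < σ i := hlt
        simp only [r]
        have := Nat.mul_lt_mul_of_pos_left this (show 0 < n by have := i.2; omega)
        omega)
      simp only at h2
      have hne : i' ≠ i := by rintro h; rw [h] at hlt; exact lt_irrefl _ hlt
      exact L'.2 i' i hne j (by rw [h2, h1, hyk])
    · by_contra hlt
      push Not at hlt
      set j' := (L.1 i).symm k with hj'
      have h1 : L.1 i j' = k := (L.1 i).apply_symm_apply k
      have h2 := hy2 (i, j') (by
        have : (τ j' : ℕ) < τ j := hlt
        simp only [r]
        omega)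
      simp only at h2
      have : j' = j := (L'.1 i).injective (by rw [h2, h1, hyk])
      rw [this] at hlt; exact lt_irrefl _ hlt
  calc _ = ∑ k ∈ (krS r (univ.image e) (r (i, j)) (e L)).image (fun y => y (i, j)),
        (if σ i ≤ σ ((colPerm L j).symm k) then (if τ j ≤ τ ((L.1 i).symm k) then w i j k else 0) else 0) := by
        refine Finset.sum_congr rfl fun k hk => ?_
        rw [if_pos (hsub k hk).1, if_pos (hsub k hk).2]
    _ ≤ _ := by
        refine Finset.sum_le_sum_of_subset_of_nonneg (Finset.subset_univ _) fun k _ _ => ?_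
        split_ifs
        · exact (hw i j k).le
        · exact le_rfl
        · exact le_rfl

lemma jensen_exp {ι : Type*} [Fintype ι] [Nonempty ι] (X : ι → ℝ) (M : ℝ)
    (h : ∑ a, X a ≤ Fintype.card ι * M) :
    Fintype.card ι * Real.exp (-M) ≤ ∑ a, Real.exp (-X a) := by
  have h1 : ∀ a, Real.exp (-M) * (1 + M - X a) ≤ Real.exp (-X a) := by
    intro a
    have h2 : Real.exp (-X a) = Real.exp (-M) * Real.exp (M - X a) := by
      rw [← Real.exp_add]; ring_nf
    rw [h2]
    refine mul_le_mul_of_nonneg_left ?_ (Real.exp_pos _).le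
    have := Real.add_one_le_exp (M - X a)
    linarith
  refine le_trans ?_ (Finset.sum_le_sum fun a _ => h1 a)
  rw [← Finset.mul_sum, Finset.sum_sub_distrib, Finset.sum_const, nsmul_eq_mul, Finset.card_univ,
    mul_comm]
  refine mul_le_mul_of_nonneg_left ?_ (Real.exp_pos _).le
  linarith

def Bn (n : ℕ) : ℝ := ∑ p : Fin n, ∑ q : Fin n,
  Real.log (2 / n + ((n : ℝ) - (p : ℕ)) * ((n : ℝ) - (q : ℕ)) / n ^ 2)

lemma log_avg {n : ℕ} (hn : 0 < n) (w : Fin n → Fin n → Fin n → ℝ) (hw : ∀ i j k, 0 < w i j k)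
    (hw1 : ∀ i j k, w i j k ≤ 1) (hs : ∀ i j, (n : ℝ) / 2 ≤ ∑ k, w i j k)
    (L : LatinSquare n) (i j : Fin n) :
    ∑ q : Equiv.Perm (Fin n) × Equiv.Perm (Fin n), Real.log (lsU w q.1 q.2 L i j) ≤
      (n.factorial : ℝ) ^ 2 * (Real.log (∑ k, w i j k) + Bn n / n ^ 2) := by
  have hn' : (0 : ℝ) < n := by exact_mod_cast hn
  set s := ∑ k, w i j k with hsdef
  have hspos : 0 < s := lt_of_lt_of_le (by positivity) (hs i j)
  have hpp : ∀ p : Fin n, (0 : ℝ) < (n : ℝ) - (p : ℕ) := fun p => by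
    have : ((p : ℕ) : ℝ) < n := by exact_mod_cast p.2
    linarith
  let a : Fin n → Fin n → ℝ := fun p q => s * (2 / n + ((n : ℝ) - (p : ℕ)) * ((n : ℝ) - (q : ℕ)) / n ^ 2)
  have hapos : ∀ p q, 0 < a p q := fun p q => by
    have := hpp p; have := hpp q; simp only [a]; positivity
  -- the linear part
  have hlin : ∑ σ : Equiv.Perm (Fin n), ∑ τ : Equiv.Perm (Fin n), lsU w σ τ L i j / a (σ i) (τ j)
      ≤ ∑ σ : Equiv.Perm (Fin n), ∑ τ : Equiv.Perm (Fin n), (1 : ℝ) := by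
    have hk : ∀ k, ∑ σ : Equiv.Perm (Fin n), ∑ τ : Equiv.Perm (Fin n),
        (if σ i ≤ σ ((colPerm L j).symm k) then (if τ j ≤ τ ((L.1 i).symm k) then w i j k / a (σ i) (τ j) else 0) else 0)
        ≤ ∑ σ : Equiv.Perm (Fin n), ∑ τ : Equiv.Perm (Fin n),
          (if k = L.1 i j then 1 / a (σ i) (τ j) else 0) +
          ∑ σ : Equiv.Perm (Fin n), ∑ τ : Equiv.Perm (Fin n), (((n : ℝ) - (σ i : ℕ)) / n) *
            ((((n : ℝ) - (τ j : ℕ)) / n) * (w i j k / a (σ i) (τ j))) := by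
      intro k
      by_cases hk : k = L.1 i j
      · refine le_trans ?_ (le_add_of_nonneg_right (Finset.sum_nonneg fun σ _ => Finset.sum_nonneg fun τ _ => ?_))
        · refine Finset.sum_le_sum fun σ _ => Finset.sum_le_sum fun τ _ => ?_
          rw [if_pos hk]
          have h1 : w i j k / a (σ i) (τ j) ≤ 1 / a (σ i) (τ j) :=
            div_le_div_of_nonneg_right (hw1 _ _ _) (hapos _ _).le
          have h2 : 0 ≤ 1 / a (σ i) (τ j) := div_nonneg zero_le_one (hapos _ _).le
          split_ifs
          · exact h1
          · exact h2
          · exact h2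
        · have := hpp (σ i); have := hpp (τ j); have := hapos (σ i) (τ j); have := hw i j k
          positivity
      · simp only [if_neg hk, Finset.sum_const_zero, zero_add]
        have hR : (colPerm L j).symm k ≠ i := by
          intro h; apply hk; rw [← colPerm_symm L j k, h]
        have hC : (L.1 i).symm k ≠ j := by
          intro h; apply hk; rw [← h, Equiv.apply_symm_apply]
        calc _ ≤ ∑ σ : Equiv.Perm (Fin n), (if σ i ≤ σ ((colPerm L j).symm k) then
              ∑ τ : Equiv.Perm (Fin n), ((((n : ℝ) - (τ j : ℕ)) / n) * (w i j k / a (σ i) (τ j))) else 0) := by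
              refine Finset.sum_le_sum fun σ _ => ?_
              split_ifs with h
              · exact perm_swap_avg j _ hC (fun q => w i j k / a (σ i) q)
                  (fun q => div_nonneg (hw _ _ _).le (hapos _ _).le)
              · simp
          _ ≤ _ := by
              refine (perm_swap_avg i _ hR (fun p => ∑ τ : Equiv.Perm (Fin n),
                ((((n : ℝ) - (τ j : ℕ)) / n) * (w i j k / a p (τ j)))) ?_).trans ?_
              · intro p
                refine Finset.sum_nonneg fun τ _ => ?_
                have := hpp (τ j); have := hapos p (τ j); have := hw i j k
                positivity
              · simp only [Finset.mul_sum]; exact le_rfl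
    have hsum := Finset.sum_le_sum fun k (_ : k ∈ (univ : Finset (Fin n))) => hk k
    have e1 : ∑ k, ∑ σ : Equiv.Perm (Fin n), ∑ τ : Equiv.Perm (Fin n),
        (if σ i ≤ σ ((colPerm L j).symm k) then (if τ j ≤ τ ((L.1 i).symm k) then w i j k / a (σ i) (τ j) else 0) else 0)
        = ∑ σ : Equiv.Perm (Fin n), ∑ τ : Equiv.Perm (Fin n), lsU w σ τ L i j / a (σ i) (τ j) := by
      rw [Finset.sum_comm]
      refine Finset.sum_congr rfl fun σ _ => ?_
      rw [Finset.sum_comm]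
      refine Finset.sum_congr rfl fun τ _ => ?_
      rw [lsU, Finset.sum_div]
      refine Finset.sum_congr rfl fun k _ => ?_
      split_ifs <;> simp
    rw [e1] at hsum
    refine hsum.trans ?_
    simp only [← Finset.sum_add_distrib]
    rw [Finset.sum_comm]
    refine Finset.sum_le_sum fun σ _ => ?_
    rw [Finset.sum_comm]
    refine Finset.sum_le_sum fun τ _ => ?_
    rw [Finset.sum_add_distrib]
    rw [Finset.sum_ite_eq' univ (L.1 i j), if_pos (Finset.mem_univ _), ← Finset.mul_sum, ← Finset.mul_sum,
      ← Finset.sum_div, ← hsdef]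
    have h1 := hpp (σ i); have h2 := hpp (τ j); have h3 := hapos (σ i) (τ j)
    have h4 : 1 / a (σ i) (τ j) + ((n : ℝ) - (σ i : ℕ)) / n * (((n : ℝ) - (τ j : ℕ)) / n * (s / a (σ i) (τ j)))
        = (1 + s * (((n : ℝ) - (σ i : ℕ)) * ((n : ℝ) - (τ j : ℕ)) / n ^ 2)) / a (σ i) (τ j) := by
      field_simp
    rw [h4, div_le_one h3]
    have h5 : 1 ≤ s * (2 / n) := by
      have := hs i j
      rw [← hsdef] at this
      rw [← mul_div_assoc, le_div_iff₀ hn']; linarith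
    simp only [a]; rw [mul_add]; linarith
  have hlog : ∀ σ τ : Equiv.Perm (Fin n), Real.log (lsU w σ τ L i j) ≤
      Real.log (a (σ i) (τ j)) + lsU w σ τ L i j / a (σ i) (τ j) - 1 := by
    intro σ τ
    have hU := lsU_pos w hw σ τ L i j
    have h1 := hapos (σ i) (τ j)
    have := Real.log_le_sub_one_of_pos (div_pos hU h1)
    rw [Real.log_div hU.ne' h1.ne'] at this
    linarith
  rw [Fintype.sum_prod_type]
  calc _ ≤ ∑ σ : Equiv.Perm (Fin n), ∑ τ : Equiv.Perm (Fin n),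
        (Real.log (a (σ i) (τ j)) + lsU w σ τ L i j / a (σ i) (τ j) - 1) :=
        Finset.sum_le_sum fun σ _ => Finset.sum_le_sum fun τ _ => hlog σ τ
    _ ≤ ∑ σ : Equiv.Perm (Fin n), ∑ τ : Equiv.Perm (Fin n), Real.log (a (σ i) (τ j)) := by
        simp only [Finset.sum_sub_distrib, Finset.sum_add_distrib]
        linarith
    _ = ∑ σ : Equiv.Perm (Fin n), (n.factorial : ℝ) / n * ∑ q, Real.log (a (σ i) q) := by
        refine Finset.sum_congr rfl fun σ _ => perm_avg1 hn j (fun q => Real.log (a (σ i) q))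
    _ = (n.factorial : ℝ) / n * ((n.factorial : ℝ) / n * ∑ p, ∑ q, Real.log (a p q)) := by
        rw [← Finset.mul_sum]
        congr 1
        exact perm_avg1 hn i (fun p => ∑ q, Real.log (a p q))
    _ = _ := by
        have : ∀ p q, Real.log (a p q) = Real.log s +
            Real.log (2 / n + ((n : ℝ) - (p : ℕ)) * ((n : ℝ) - (q : ℕ)) / n ^ 2) := by
          intro p q
          have := hpp p; have := hpp q
          rw [← Real.log_mul hspos.ne' (by positivity)]
        simp only [this, Finset.sum_add_distrib, Finset.sum_const, Finset.card_univ, Fintype.card_fin, nsmul_eq_mul]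
        rw [Bn]
        field_simp

lemma ls_upper {n : ℕ} (hn : 0 < n) (w : Fin n → Fin n → Fin n → ℝ) (hw : ∀ i j k, 0 < w i j k)
    (hw1 : ∀ i j k, w i j k ≤ 1) (hs : ∀ i j, (n : ℝ) / 2 ≤ ∑ k, w i j k) :
    ∑ L : LatinSquare n, ∏ c : Fin n × Fin n, w c.1 c.2 (L.1 c.1 c.2) ≤
      Real.exp (∑ c : Fin n × Fin n, Real.log (∑ k, w c.1 c.2 k) + Bn n) := by
  have hn' : (0 : ℝ) < n := by exact_mod_cast hn
  set M := ∑ c : Fin n × Fin n, Real.log (∑ k, w c.1 c.2 k) + Bn n with hM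
  have hcard : (Fintype.card (Equiv.Perm (Fin n) × Equiv.Perm (Fin n)) : ℝ) = (n.factorial : ℝ) ^ 2 := by
    rw [Fintype.card_prod, Fintype.card_perm, Fintype.card_fin]; push_cast; ring
  have hf : (0 : ℝ) < (n.factorial : ℝ) ^ 2 := by positivity
  have h1 : ∀ L : LatinSquare n, (n.factorial : ℝ) ^ 2 * Real.exp (-M) ≤
      ∑ q : Equiv.Perm (Fin n) × Equiv.Perm (Fin n),
        Real.exp (-∑ c : Fin n × Fin n, Real.log (lsU w q.1 q.2 L c.1 c.2)) := by
    intro L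
    rw [← hcard]
    apply jensen_exp
    rw [hcard, Finset.sum_comm]
    refine (Finset.sum_le_sum fun c _ => log_avg hn w hw hw1 hs L c.1 c.2).trans ?_
    rw [← Finset.mul_sum, Finset.sum_add_distrib]
    simp only [Finset.sum_const, Finset.card_univ, Fintype.card_prod, Fintype.card_fin, nsmul_eq_mul]
    apply le_of_eq
    rw [hM]; push_cast; field_simp
  have h2 : ∑ q : Equiv.Perm (Fin n) × Equiv.Perm (Fin n), ∑ L : LatinSquare n,
      ∏ c : Fin n × Fin n, w c.1 c.2 (L.1 c.1 c.2) / lsU w q.1 q.2 L c.1 c.2 ≤ (n.factorial : ℝ) ^ 2 := by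
    refine (Finset.sum_le_sum fun q _ => ls_kraft w hw q.1 q.2).trans ?_
    rw [Finset.sum_const, Finset.card_univ, nsmul_eq_mul, hcard, mul_one]
  rw [Finset.sum_comm] at h2
  have h3 : ∀ L : LatinSquare n, ((n.factorial : ℝ) ^ 2 * Real.exp (-M)) * ∏ c : Fin n × Fin n, w c.1 c.2 (L.1 c.1 c.2)
      ≤ ∑ q : Equiv.Perm (Fin n) × Equiv.Perm (Fin n),
      ∏ c : Fin n × Fin n, w c.1 c.2 (L.1 c.1 c.2) / lsU w q.1 q.2 L c.1 c.2 := by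
    intro L
    refine (mul_le_mul_of_nonneg_right (h1 L) (Finset.prod_nonneg fun c _ => (hw _ _ _).le)).trans ?_
    rw [Finset.sum_mul]
    refine Finset.sum_le_sum fun q _ => le_of_eq ?_
    rw [Finset.prod_div_distrib, ← Finset.sum_neg_distrib, Real.exp_sum, div_eq_mul_inv, mul_comm,
      ← Finset.prod_inv_distrib]
    congr 1
    refine Finset.prod_congr rfl fun c _ => ?_
    rw [Real.exp_neg, Real.exp_log (lsU_pos w hw _ _ _ _ _)]
  have h4 := (Finset.sum_le_sum fun L (_ : L ∈ (univ : Finset (LatinSquare n))) => h3 L).trans h2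
  rw [← Finset.mul_sum, mul_assoc] at h4
  have h5 : Real.exp (-M) * ∑ L : LatinSquare n, ∏ c : Fin n × Fin n, w c.1 c.2 (L.1 c.1 c.2) ≤ 1 := by
    by_contra hgt
    push Not at hgt
    have := mul_lt_mul_of_pos_left hgt hf
    linarith
  rw [Real.exp_neg, inv_mul_le_iff₀ (Real.exp_pos _), mul_one] at h5
  exact h5

lemma log_fact_le (n : ℕ) (hn : 1 ≤ n) :
    Real.log (n.factorial : ℝ) ≤ (n + 1) * Real.log n - n + 1 := by
  induction n, hn using Nat.le_induction with
  | base => simp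
  | succ n hn ih =>
    have hn' : (0 : ℝ) < n := by exact_mod_cast hn
    have hf : (0 : ℝ) < n.factorial := by exact_mod_cast n.factorial_pos
    rw [Nat.factorial_succ]
    push_cast
    rw [Real.log_mul (by positivity) hf.ne']
    have h1 : 1 ≤ ((n : ℝ) + 1) * (Real.log (n + 1) - Real.log n) := by
      rw [← Real.log_div (by positivity) hn'.ne']
      have := Real.one_sub_inv_le_log_of_pos (x := ((n : ℝ) + 1) / n) (by positivity)
      calc (1 : ℝ) = (n + 1) * (1 - (((n : ℝ) + 1) / n)⁻¹) := by field_simp; ring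
        _ ≤ _ := mul_le_mul_of_nonneg_left this (by positivity)
    linarith

lemma sum_inv_sqrt_le (n : ℕ) : ∑ p ∈ Finset.range n, 1 / Real.sqrt ((p : ℝ) + 1) ≤ 2 * Real.sqrt n := by
  induction n with
  | zero => simp
  | succ n ih =>
    rw [Finset.sum_range_succ]
    push_cast
    have h1 : Real.sqrt n ≤ Real.sqrt ((n : ℝ) + 1) := Real.sqrt_le_sqrt (by linarith)
    have h0 : 0 < Real.sqrt ((n : ℝ) + 1) := Real.sqrt_pos.2 (by positivity)
    have h2 := Real.sq_sqrt (show (0 : ℝ) ≤ n by positivity)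
    have h3 := Real.sq_sqrt (show (0 : ℝ) ≤ (n : ℝ) + 1 by positivity)
    have h4 : 1 / Real.sqrt ((n : ℝ) + 1) ≤ 2 * Real.sqrt ((n : ℝ) + 1) - 2 * Real.sqrt n := by
      rw [div_le_iff₀ h0]
      nlinarith [sq_nonneg (Real.sqrt ((n : ℝ) + 1) - Real.sqrt n)]
    linarith

lemma sum_rev (n : ℕ) (f : ℝ → ℝ) :
    ∑ p : Fin n, f ((n : ℝ) - (p : ℕ)) = ∑ p ∈ Finset.range n, f ((p : ℝ) + 1) := by
  rw [Finset.sum_range (fun p => f ((p : ℝ) + 1))]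
  refine Fintype.sum_equiv Fin.revPerm _ _ fun p => ?_
  congr 1
  simp only [Fin.revPerm_apply, Fin.val_rev]
  rw [Nat.cast_sub (by have := p.2; omega)]
  push_cast; ring

lemma log_one_add_le (x : ℝ) (hx : 0 ≤ x) : Real.log (1 + x) ≤ 2 * Real.sqrt x := by
  have h0 := Real.sqrt_nonneg x
  have h1 : 1 + x ≤ (1 + Real.sqrt x) ^ 2 := by
    nlinarith [Real.sq_sqrt hx]
  calc _ ≤ Real.log ((1 + Real.sqrt x) ^ 2) := Real.log_le_log (by linarith) h1
    _ = 2 * Real.log (1 + Real.sqrt x) := by rw [Real.log_pow]; norm_num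
    _ ≤ _ := by
      have := Real.log_le_sub_one_of_pos (show 0 < 1 + Real.sqrt x by linarith)
      linarith

lemma Bn_le (n : ℕ) (hn : 1 ≤ n) : Bn n ≤ -2 * (n : ℝ) ^ 2 + 18 * (n * Real.sqrt n) := by
  have hn' : (0 : ℝ) < n := by exact_mod_cast hn
  have hpp : ∀ p : Fin n, (0 : ℝ) < (n : ℝ) - (p : ℕ) := fun p => by
    have : ((p : ℕ) : ℝ) < n := by exact_mod_cast p.2
    linarith
  have hterm : ∀ a b : ℝ, 0 < a → 0 < b → Real.log (2 / n + a * b / n ^ 2) ≤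
      (Real.log a - Real.log n) + (Real.log b - Real.log n) +
        2 * Real.sqrt (2 * n) * ((1 / Real.sqrt a) * (1 / Real.sqrt b)) := by
    intro a b ha hb
    have h1 : 2 / n + a * b / n ^ 2 = (a / n) * ((b / n) * (1 + 2 * n / (a * b))) := by
      field_simp; ring
    rw [h1, Real.log_mul (by positivity) (by positivity), Real.log_mul (by positivity) (by positivity),
      Real.log_div ha.ne' hn'.ne', Real.log_div hb.ne' hn'.ne']
    have h2 := log_one_add_le (2 * n / (a * b)) (by positivity)
    rw [Real.sqrt_div (by positivity), Real.sqrt_mul ha.le] at h2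
    have h3 : 2 * (Real.sqrt (2 * n) / (Real.sqrt a * Real.sqrt b)) =
      2 * Real.sqrt (2 * n) * ((1 / Real.sqrt a) * (1 / Real.sqrt b)) := by
      have := Real.sqrt_pos.2 ha; have := Real.sqrt_pos.2 hb
      field_simp
    linarith
  have hA : ∑ p : Fin n, (Real.log ((n : ℝ) - (p : ℕ)) - Real.log n) ≤ Real.log n - n + 1 := by
    rw [Finset.sum_sub_distrib, sum_rev n Real.log]
    have : ∑ p ∈ Finset.range n, Real.log ((p : ℝ) + 1) = Real.log (n.factorial : ℝ) := by
      rw [← Finset.prod_range_add_one_eq_factorial]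
      push_cast
      rw [Real.log_prod]
      intro p _; positivity
    rw [this]
    simp only [Finset.sum_const, Finset.card_univ, Fintype.card_fin, nsmul_eq_mul]
    have := log_fact_le n hn
    linarith
  have hS : ∑ p : Fin n, 1 / Real.sqrt ((n : ℝ) - (p : ℕ)) ≤ 2 * Real.sqrt n := by
    rw [sum_rev n (fun x => 1 / Real.sqrt x)]
    exact sum_inv_sqrt_le n
  have hS0 : 0 ≤ ∑ p : Fin n, 1 / Real.sqrt ((n : ℝ) - (p : ℕ)) :=
    Finset.sum_nonneg fun p _ => by positivity
  have h1 : Bn n ≤ 2 * (n * ∑ p : Fin n, (Real.log ((n : ℝ) - (p : ℕ)) - Real.log n)) +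
      2 * Real.sqrt (2 * n) * ((∑ p : Fin n, 1 / Real.sqrt ((n : ℝ) - (p : ℕ))) *
        (∑ p : Fin n, 1 / Real.sqrt ((n : ℝ) - (p : ℕ)))) := by
    unfold Bn
    refine (Finset.sum_le_sum fun p _ => Finset.sum_le_sum fun q _ => hterm _ _ (hpp p) (hpp q)).trans (le_of_eq ?_)
    rw [Finset.sum_mul_sum, Finset.mul_sum]
    simp only [Finset.sum_add_distrib, Finset.mul_sum, Finset.sum_const, Finset.card_univ, Fintype.card_fin, nsmul_eq_mul]
    simp only [← Finset.mul_sum]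
    ring
  set r := Real.sqrt n with hr
  have hr1 : 1 ≤ r := by
    rw [hr]; apply Real.one_le_sqrt.2; exact_mod_cast hn
  have hrr : r * r = n := Real.mul_self_sqrt hn'.le
  have hlog : Real.log n ≤ 2 * r := by
    have := Real.log_le_sub_one_of_pos (show 0 < r by linarith)
    have h2 : Real.log n = 2 * Real.log r := by
      rw [← hrr, Real.log_mul (by linarith) (by linarith)]; ring
    linarith
  have h2r : Real.sqrt (2 * n) ≤ 1.5 * r := by
    rw [Real.sqrt_mul (by norm_num), ← hr]
    have : Real.sqrt 2 ≤ 1.5 := by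
      rw [Real.sqrt_le_left (by norm_num)]; norm_num
    nlinarith
  have hSS : (∑ p : Fin n, 1 / Real.sqrt ((n : ℝ) - (p : ℕ))) *
        (∑ p : Fin n, 1 / Real.sqrt ((n : ℝ) - (p : ℕ))) ≤ 4 * n := by
    calc _ ≤ (2 * r) * (2 * r) := mul_le_mul hS hS hS0 (by linarith)
      _ = 4 * n := by rw [← hrr]; ring
  have h3 : 2 * Real.sqrt (2 * n) * ((∑ p : Fin n, 1 / Real.sqrt ((n : ℝ) - (p : ℕ))) *
        (∑ p : Fin n, 1 / Real.sqrt ((n : ℝ) - (p : ℕ)))) ≤ (3 * r) * (4 * n) :=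
    mul_le_mul (by linarith) hSS (by positivity) (by linarith)
  have h4 : 2 * (n * ∑ p : Fin n, (Real.log ((n : ℝ) - (p : ℕ)) - Real.log n)) ≤ 2 * (n * (2 * r - n + r)) := by
    have := mul_le_mul_of_nonneg_left (hA.trans (show Real.log n - n + 1 ≤ 2 * r - n + r by linarith)) hn'.le
    linarith
  nlinarith

def hitE {n : ℕ} (E : Finset (Fin n × Fin n × Fin n)) (L : LatinSquare n) : ℕ :=
  (univ.filter fun c : Fin n × Fin n => (c.1, c.2, L.1 c.1 c.2) ∈ E).card

lemma hit_mgf {n : ℕ} (hn : 1 ≤ n) (E : Finset (Fin n × Fin n × Fin n)) :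
    ∑ L : LatinSquare n, (1 / 2 : ℝ) ^ hitE E L ≤
      (Fintype.card (LatinSquare n) : ℝ) *
        Real.exp (18 * (n * Real.sqrt n) - (E.card : ℝ) / (2 * n)) := by
  have hn' : (0 : ℝ) < n := by exact_mod_cast hn
  let w : Fin n → Fin n → Fin n → ℝ := fun i j k => if (i, j, k) ∈ E then 1 / 2 else 1
  let e : Fin n × Fin n → ℝ := fun c => ((univ.filter fun k => (c.1, c.2, k) ∈ E).card : ℝ)
  have hsum : ∀ c : Fin n × Fin n, ∑ k, w c.1 c.2 k = n - e c / 2 := by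
    intro c
    have : ∀ k, w c.1 c.2 k = 1 - (if (c.1, c.2, k) ∈ E then 1 else 0) / 2 := by
      intro k; simp only [w]; split_ifs <;> norm_num
    simp only [this, Finset.sum_sub_distrib, ← Finset.sum_div, Finset.sum_boole, e]
    simp
  have he : ∀ c, e c ≤ n := by
    intro c
    have := Finset.card_le_univ (univ.filter fun k => (c.1, c.2, k) ∈ E)
    rw [Fintype.card_fin] at this
    simp only [e]; exact_mod_cast this
  have hes : ∑ c, e c = E.card := by
    simp only [e]
    rw [← Nat.cast_sum]
    congr 1
    have h1 : ∀ c : Fin n × Fin n, (univ.filter fun k => (c.1, c.2, k) ∈ E).card =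
        ∑ k, if (c.1, c.2, k) ∈ E then 1 else 0 := fun c => by rw [Finset.card_filter]
    simp only [h1]
    rw [Fintype.sum_prod_type]
    have h2 : E.card = ∑ t : Fin n × Fin n × Fin n, if t ∈ E then 1 else 0 := by simp
    rw [h2, Fintype.sum_prod_type]
    refine Finset.sum_congr rfl fun i _ => ?_
    rw [Fintype.sum_prod_type]
  have h := ls_upper hn w (fun i j k => by simp only [w]; split_ifs <;> norm_num)
    (fun i j k => by simp only [w]; split_ifs <;> norm_num)
    (fun i j => by
      have h1 := hsum (i, j)
      have h2 := he (i, j)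
      simp only at h1
      rw [h1]; linarith)
  have hprod : ∀ L : LatinSquare n, ∏ c : Fin n × Fin n, w c.1 c.2 (L.1 c.1 c.2) = (1 / 2 : ℝ) ^ hitE E L := by
    intro L
    simp only [w]
    rw [Finset.prod_ite]
    simp [hitE]
  simp only [hprod] at h
  refine h.trans ?_
  have hl := latin_lower n hn
  refine le_trans ?_ (mul_le_mul_of_nonneg_right hl (Real.exp_pos _).le)
  rw [← Real.exp_add]
  apply Real.exp_le_exp.2
  have h1 : ∑ c : Fin n × Fin n, Real.log (∑ k, w c.1 c.2 k) ≤ n ^ 2 * Real.log n - E.card / (2 * n) := by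
    calc _ ≤ ∑ c : Fin n × Fin n, (Real.log n - e c / (2 * n)) := by
          refine Finset.sum_le_sum fun c _ => ?_
          rw [hsum]
          have h2 := he c
          have h3 : (n : ℝ) - e c / 2 = n * (1 - e c / (2 * n)) := by field_simp
          have h4 : e c / (2 * n) ≤ 1 / 2 := by
            rw [div_le_iff₀ (by positivity)]; linarith
          rw [h3, Real.log_mul hn'.ne' (by linarith)]
          have := Real.log_le_sub_one_of_pos (show 0 < 1 - e c / (2 * n) by linarith)
          linarith
      _ = _ := by
          rw [Finset.sum_sub_distrib, ← Finset.sum_div, hes, Finset.sum_const, Finset.card_univ,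
            Fintype.card_prod, Fintype.card_fin, nsmul_eq_mul]
          push_cast; ring
  have h2 := Bn_le n hn
  nlinarith
end UpperC

section PermD

def pX {n : ℕ} (S T : Finset (Fin n)) (σ : Equiv.Perm (Fin n)) : ℕ := (S.filter fun j => σ j ∈ T).card

lemma permN {n : ℕ} (T A : Finset (Fin n)) :
    ∑ σ : Equiv.Perm (Fin n), (if ∀ j ∈ A, σ j ∈ T then (1 : ℝ) else 0) ≤
      n.factorial * ((T.card : ℝ) / n) ^ A.card := by
  induction A using Finset.induction_on with
  | empty => simp [Fintype.card_perm]
  | insert a A ha ih =>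
    let N : Fin n → ℝ := fun b => ∑ σ : Equiv.Perm (Fin n), (if ∀ j ∈ insert b A, σ j ∈ T then (1 : ℝ) else 0)
    have hsym : ∀ b ∈ Aᶜ, N b = N a := by
      intro b hb
      rw [Finset.mem_compl] at hb
      simp only [N]
      refine Fintype.sum_equiv (Equiv.mulRight (Equiv.swap a b)) _ _ fun σ => ?_
      have : (∀ j ∈ insert b A, σ j ∈ T) ↔ (∀ j ∈ insert a A, (Equiv.mulRight (Equiv.swap a b) σ) j ∈ T) := by
        simp only [Finset.forall_mem_insert, Equiv.coe_mulRight, Equiv.Perm.mul_apply, Equiv.swap_apply_left]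
        refine and_congr_right fun _ => forall_congr' fun j => imp_congr_right fun hj => ?_
        rw [Equiv.swap_apply_of_ne_of_ne]
        · rintro rfl; exact ha hj
        · rintro rfl; exact hb hj
      simp only [this]
    have hAn : A.card < n := by
      have h1 : (insert a A).card ≤ n := by
        have := Finset.card_le_univ (insert a A); rwa [Fintype.card_fin] at this
      rw [Finset.card_insert_of_notMem ha] at h1; omega
    have hTn : T.card ≤ n := by have := Finset.card_le_univ T; rwa [Fintype.card_fin] at this
    have hAn' : (A.card : ℝ) < n := by exact_mod_cast hAn
    have hTn' : (T.card : ℝ) ≤ n := by exact_mod_cast hTn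
    have hA0 : (0 : ℝ) ≤ A.card := Nat.cast_nonneg _
    have hT0 : (0 : ℝ) ≤ T.card := Nat.cast_nonneg _
    have h1 : ((n : ℝ) - A.card) * N a = ∑ b ∈ Aᶜ, N b := by
      rw [Finset.sum_congr rfl hsym, Finset.sum_const, nsmul_eq_mul, Finset.card_compl, Fintype.card_fin,
        Nat.cast_sub hAn.le]
    have h2 : ∑ b ∈ Aᶜ, N b = ((T.card : ℝ) - A.card) *
        ∑ σ : Equiv.Perm (Fin n), (if ∀ j ∈ A, σ j ∈ T then (1 : ℝ) else 0) := by
      simp only [N]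
      rw [Finset.sum_comm, Finset.mul_sum]
      refine Finset.sum_congr rfl fun σ _ => ?_
      by_cases hσ : ∀ j ∈ A, σ j ∈ T
      · have hiff : ∀ b, (∀ j ∈ insert b A, σ j ∈ T) ↔ σ b ∈ T := fun b => by
          rw [Finset.forall_mem_insert]; exact ⟨fun h => h.1, fun h => ⟨h, hσ⟩⟩
        rw [if_pos hσ, mul_one]
        simp only [hiff]
        rw [Finset.sum_boole]
        have h3 : (Aᶜ.filter fun b => σ b ∈ T) = (T.image σ.symm) \ A := by
          ext b; simp [Equiv.symm_apply_eq, and_comm]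
        have h4 : A ⊆ T.image σ.symm := by
          intro b hb
          rw [Finset.mem_image]
          exact ⟨σ b, hσ b hb, by simp⟩
        rw [h3, Finset.card_sdiff_of_subset h4, Nat.cast_sub (Finset.card_le_card h4),
          Finset.card_image_of_injective _ σ.symm.injective]
      · simp only [Finset.forall_mem_insert, hσ, and_false, if_false, mul_zero, Finset.sum_const_zero]
    set M := ∑ σ : Equiv.Perm (Fin n), (if ∀ j ∈ A, σ j ∈ T then (1 : ℝ) else 0) with hM
    have hM0 : 0 ≤ M := Finset.sum_nonneg fun σ _ => by split_ifs <;> norm_num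
    have h5 : N a ≤ (T.card : ℝ) / n * M := by
      have hpos : (0 : ℝ) < n - A.card := by linarith
      have hn0 : (0 : ℝ) < n := by linarith
      rw [← mul_le_mul_iff_right₀ hpos, h1, h2, ← mul_assoc]
      refine mul_le_mul_of_nonneg_right ?_ hM0
      rw [← mul_div_assoc, le_div_iff₀ hn0]
      nlinarith
    rw [Finset.card_insert_of_notMem ha, pow_succ]
    calc _ = N a := rfl
      _ ≤ (T.card : ℝ) / n * M := h5
      _ ≤ (T.card : ℝ) / n * (n.factorial * ((T.card : ℝ) / n) ^ A.card) :=
          mul_le_mul_of_nonneg_left ih (by positivity)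
      _ = _ := by ring

lemma perm_mgf {n : ℕ} (S T : Finset (Fin n)) (y : ℝ) (hy : 1 ≤ y) :
    ∑ σ : Equiv.Perm (Fin n), y ^ pX S T σ ≤
      n.factorial * Real.exp ((y - 1) * S.card * T.card / n) := by
  have h1 : ∀ σ : Equiv.Perm (Fin n), y ^ pX S T σ =
      ∑ A ∈ S.powerset, (y - 1) ^ A.card * (if ∀ j ∈ A, σ j ∈ T then (1 : ℝ) else 0) := by
    intro σ
    have : y ^ pX S T σ = ∏ j ∈ S, ((if σ j ∈ T then (y - 1) else 0) + 1) := by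
      rw [pX, ← Finset.prod_const, Finset.prod_filter]
      refine Finset.prod_congr rfl fun j _ => ?_
      split_ifs <;> ring
    rw [this, Finset.prod_add]
    refine Finset.sum_congr rfl fun A _ => ?_
    rw [Finset.prod_const_one, mul_one, Finset.prod_ite_zero, Finset.prod_const]
    split_ifs <;> simp
  simp only [h1]
  rw [Finset.sum_comm]
  calc _ ≤ ∑ A ∈ S.powerset, (y - 1) ^ A.card * (n.factorial * ((T.card : ℝ) / n) ^ A.card) := by
        refine Finset.sum_le_sum fun A _ => ?_
        rw [← Finset.mul_sum]
        exact mul_le_mul_of_nonneg_left (permN T A) (pow_nonneg (by linarith) _)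
    _ = n.factorial * ((y - 1) * T.card / n + 1) ^ S.card := by
        rw [← Finset.prod_const, Finset.prod_add, Finset.mul_sum]
        refine Finset.sum_congr rfl fun A _ => ?_
        rw [Finset.prod_const_one, mul_one, Finset.prod_const, mul_div_assoc, mul_pow]; ring
    _ ≤ n.factorial * (Real.exp ((y - 1) * T.card / n)) ^ S.card := by
        have : 0 ≤ (y - 1) * T.card / n :=
          div_nonneg (mul_nonneg (by linarith) (Nat.cast_nonneg _)) (Nat.cast_nonneg _)
        refine mul_le_mul_of_nonneg_left (pow_le_pow_left₀ (by linarith) (Real.add_one_le_exp _) _) (by positivity)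
    _ = _ := by
        rw [← Real.exp_nat_mul]; congr 2; ring

def symPerm {n : ℕ} (L : LatinSquare n) (k : Fin n) : Equiv.Perm (Fin n) :=
  Equiv.ofBijective (fun i => (L.1 i).symm k) (by
    have h : Function.Injective (fun i => (L.1 i).symm k) := by
      intro a b hab
      by_contra hne
      simp only at hab
      apply L.2 a b hne ((L.1 a).symm k)
      rw [Equiv.apply_symm_apply, hab, Equiv.apply_symm_apply]
    exact ⟨h, Finite.injective_iff_surjective.1 h⟩)

def vp {n : ℕ} (v : Fin 3 × Fin n) (L : LatinSquare n) : Equiv.Perm (Fin n) :=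
  if v.1 = 0 then L.1 v.2 else if v.1 = 1 then colPerm L v.2 else symPerm L v.2

lemma avg_transfer {n : ℕ} (g : LatinSquare n → Equiv.Perm (Fin n))
    (e : Equiv.Perm (Fin n) → LatinSquare n → LatinSquare n) (he : ∀ ρ, Function.Injective (e ρ))
    (hg : ∀ ρ L, g (e ρ L) = ρ * g L) (F : Equiv.Perm (Fin n) → ℝ) :
    (n.factorial : ℝ) * ∑ L, F (g L) = Fintype.card (LatinSquare n) * ∑ ρ, F ρ := by
  have h1 : ∀ ρ, ∑ L, F (ρ * g L) = ∑ L, F (g L) := by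
    intro ρ
    simp only [← hg]
    exact Fintype.sum_bijective (e ρ) ⟨he ρ, Finite.injective_iff_surjective.1 (he ρ)⟩ _ _ fun _ => rfl
  have h2 : ∑ ρ : Equiv.Perm (Fin n), ∑ L, F (ρ * g L) = (n.factorial : ℝ) * ∑ L, F (g L) := by
    simp only [h1]
    rw [Finset.sum_const, Finset.card_univ, Fintype.card_perm, Fintype.card_fin, nsmul_eq_mul]
  rw [← h2, Finset.sum_comm]
  have h3 : ∀ L, ∑ ρ : Equiv.Perm (Fin n), F (ρ * g L) = ∑ ρ, F ρ := fun L =>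
    Equiv.sum_comp (Equiv.mulRight (g L)) F
  simp only [h3]
  rw [Finset.sum_const, Finset.card_univ, nsmul_eq_mul]

def lMul {n : ℕ} (ρ : Equiv.Perm (Fin n)) (L : LatinSquare n) : LatinSquare n :=
  ⟨fun i => ρ * L.1 i, fun i j hij x h => L.2 i j hij x (ρ.injective h)⟩

def rMul {n : ℕ} (ρ : Equiv.Perm (Fin n)) (L : LatinSquare n) : LatinSquare n :=
  ⟨fun i => L.1 i * ρ⁻¹, fun i j hij x h => L.2 i j hij (ρ⁻¹ x) h⟩

lemma vp_avg {n : ℕ} (v : Fin 3 × Fin n) (F : Equiv.Perm (Fin n) → ℝ) :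
    (n.factorial : ℝ) * ∑ L, F (vp v L) = Fintype.card (LatinSquare n) * ∑ ρ, F ρ := by
  have hl : ∀ ρ : Equiv.Perm (Fin n), Function.Injective (lMul ρ) := by
    intro ρ L L' h
    apply Subtype.ext; funext i
    have := congrFun (congrArg Subtype.val h) i
    exact mul_left_cancel this
  have hr : ∀ ρ : Equiv.Perm (Fin n), Function.Injective (rMul ρ) := by
    intro ρ L L' h
    apply Subtype.ext; funext i
    have := congrFun (congrArg Subtype.val h) i
    exact mul_right_cancel this
  by_cases h0 : v.1 = 0
  · exact avg_transfer _ lMul hl (fun ρ L => by simp [vp, h0, lMul]) F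
  · by_cases h1 : v.1 = 1
    · exact avg_transfer _ lMul hl (fun ρ L => by
        ext i
        simp only [vp, h1, if_true, one_ne_zero, if_false]
        rfl) F
    · exact avg_transfer _ rMul hr (fun ρ L => by
        ext i
        simp only [vp, h0, h1, if_false]
        simp only [symPerm, rMul, Equiv.ofBijective_apply, Equiv.Perm.mul_apply]
        congr 1) F

lemma vp_mgf {n : ℕ} (v : Fin 3 × Fin n) (S T : Finset (Fin n)) (y : ℝ) (hy : 1 ≤ y) :
    ∑ L, y ^ pX S T (vp v L) ≤
      Fintype.card (LatinSquare n) * Real.exp ((y - 1) * S.card * T.card / n) := by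
  have h := vp_avg v (fun σ => y ^ pX S T σ)
  have hf : (0 : ℝ) < n.factorial := by positivity
  rw [← mul_le_mul_iff_right₀ hf, h]
  have := mul_le_mul_of_nonneg_left (perm_mgf S T y hy) (Nat.cast_nonneg (α := ℝ) (Fintype.card (LatinSquare n)))
  linarith

lemma sum_pi_pow {α : Type*} [Fintype α] (d : ℕ) (g : α → ℝ) :
    ∑ x : Fin d → α, ∏ m, g (x m) = (∑ a, g a) ^ d := by
  have := Finset.prod_univ_sum (fun _ : Fin d => (univ : Finset α)) (fun _ a => g a)
  rw [Fintype.piFinset_univ] at this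
  rw [← this]; simp

lemma markov_mult {α : Type*} [Fintype α] (d : ℕ) (X : α → ℕ) (y : ℝ) (hy : 1 ≤ y) (M r : ℝ)
    (hM : ∑ a, y ^ X a ≤ Fintype.card α * Real.exp M) :
    ((univ.filter fun x : Fin d → α => r ≤ ((∑ m, X (x m) : ℕ) : ℝ)).card : ℝ) ≤
      (Fintype.card α : ℝ) ^ d * Real.exp (d * M - r * Real.log y) := by
  have hy0 : 0 < y := by linarith
  have h1 : ((univ.filter fun x : Fin d → α => r ≤ ((∑ m, X (x m) : ℕ) : ℝ)).card : ℝ) * Real.exp (r * Real.log y)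
      ≤ ∑ x : Fin d → α, ∏ m, y ^ X (x m) := by
    rw [← nsmul_eq_mul, ← Finset.sum_const]
    refine le_trans ?_ (Finset.sum_le_sum_of_subset_of_nonneg
      (Finset.subset_univ (univ.filter fun x : Fin d → α => r ≤ ((∑ m, X (x m) : ℕ) : ℝ)))
      fun x _ _ => Finset.prod_nonneg fun m _ => by positivity)
    refine Finset.sum_le_sum fun x hx => ?_
    rw [Finset.mem_filter] at hx
    rw [Finset.prod_pow_eq_pow_sum, ← Real.rpow_natCast, Real.rpow_def_of_pos hy0, mul_comm (Real.log y)]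
    exact Real.exp_le_exp.2 (mul_le_mul_of_nonneg_right hx.2 (Real.log_nonneg hy))
  rw [sum_pi_pow d (fun a => y ^ X a)] at h1
  have h2 : (∑ a, y ^ X a) ^ d ≤ (Fintype.card α * Real.exp M) ^ d :=
    pow_le_pow_left₀ (Finset.sum_nonneg fun a _ => by positivity) hM d
  rw [mul_pow, ← Real.exp_nat_mul] at h2
  rw [Real.exp_sub, ← mul_div_assoc, le_div_iff₀ (Real.exp_pos _)]
  exact h1.trans h2

lemma vp_tail {n d : ℕ} (v : Fin 3 × Fin n) (S T : Finset (Fin n)) (y : ℝ) (hy : 1 ≤ y) (r : ℝ) :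
    ((univ.filter fun Ls : Fin d → LatinSquare n => r ≤ ((∑ m, pX S T (vp v (Ls m)) : ℕ) : ℝ)).card : ℝ) ≤
      (Fintype.card (LatinSquare n) : ℝ) ^ d *
        Real.exp (d * ((y - 1) * S.card * T.card / n) - r * Real.log y) :=
  markov_mult d (fun L => pX S T (vp v L)) y hy _ r (vp_mgf v S T y hy)
end PermD

section SmallE

def thr (n s : ℕ) : ℝ := if n < 100 * s then 3 / 8 * s else s / 10

lemma choose_heavy {n s : ℕ} : ((2 * n).choose s : ℝ) ≤ Real.exp (2 * n) := by
  have h1 : ((2 * n).choose s : ℝ) ≤ 2 ^ (2 * n) := by exact_mod_cast Nat.choose_le_two_pow (2 * n) s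
  have h2 : (2 : ℝ) ^ (2 * n) ≤ Real.exp 1 ^ (2 * n) := by
    gcongr
    have := Real.add_one_le_exp 1
    linarith
  rw [← Real.exp_nat_mul] at h2
  refine h1.trans (h2.trans (le_of_eq ?_))
  push_cast; ring_nf

lemma choose_light {n s : ℕ} (hs : 1 ≤ s) (hn : 100 * s ≤ n) :
    ((2 * n).choose s : ℝ) ≤ Real.exp (s * (2 * Real.log (n / s))) := by
  have hs0 : (0 : ℝ) < s := by exact_mod_cast hs
  have hx : (100 : ℝ) ≤ (n : ℝ) / s := by
    rw [le_div_iff₀ hs0]; exact_mod_cast hn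
  have h1 : ((2 * n).choose s : ℝ) ≤ ((2 * n : ℕ) : ℝ) ^ s / s.factorial := Nat.choose_le_pow_div s (2 * n)
  have h2 := Real.pow_div_factorial_le_exp (x := s) hs0.le s
  have hf : (0 : ℝ) < s.factorial := by positivity
  have h3 : ((2 * n : ℕ) : ℝ) ^ s / s.factorial = (2 * (n / s : ℝ)) ^ s * ((s : ℝ) ^ s / s.factorial) := by
    push_cast
    rw [← mul_div_assoc, ← mul_pow]
    congr 2
    field_simp
  rw [h3] at h1
  have h4 : (2 * (n / s : ℝ)) ^ s * ((s : ℝ) ^ s / s.factorial) ≤ (2 * (n / s : ℝ)) ^ s * Real.exp s :=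
    mul_le_mul_of_nonneg_left h2 (by positivity)
  refine (h1.trans h4).trans ?_
  have h5 : Real.exp (s * (2 * Real.log (n / s))) = ((n / s : ℝ) * (n / s)) ^ s := by
    rw [Real.exp_nat_mul]
    congr 1
    rw [two_mul, Real.exp_add, Real.exp_log (by linarith)]
  have h6 : Real.exp (s : ℝ) = Real.exp 1 ^ s := by rw [← Real.exp_nat_mul, mul_one]
  rw [h5, h6, ← mul_pow]
  apply pow_le_pow_left₀ (by positivity)
  have := Real.exp_one_lt_d9
  nlinarith

lemma pow_light {n s : ℕ} (hs : 1 ≤ s) (hn : 100 * s ≤ n) :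
    Real.exp (-(s * Real.log (n / s))) ≤ 2 / n := by
  have hs0 : (0 : ℝ) < s := by exact_mod_cast hs
  have hn' : (100 : ℝ) * s ≤ n := by exact_mod_cast hn
  have hx : (100 : ℝ) ≤ (n : ℝ) / s := by
    rw [le_div_iff₀ hs0]; exact hn'
  rw [Real.exp_neg, Real.exp_nat_mul, Real.exp_log (by linarith)]
  have h1 := one_add_mul_sub_le_pow (a := (n : ℝ) / s) (by linarith) s
  have h2 : 1 + (s : ℝ) * ((n : ℝ) / s - 1) = 1 + n - s := by field_simp; ring
  rw [h2] at h1
  rw [inv_le_comm₀ (by positivity) (by have : (0:ℝ) < n := by linarith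
                                       positivity), inv_div]
  linarith

lemma bad_prob {n d : ℕ} (hd : (d : ℝ) = 10 ^ 11) (v : Fin 3 × Fin n) (S T : Finset (Fin n))
    (h1 : 1 ≤ S.card + T.card) (h2 : S.card + T.card ≤ n) :
    ((2 * n).choose (S.card + T.card) : ℝ) *
    ((univ.filter fun Ls : Fin d → LatinSquare n =>
      d * thr n (S.card + T.card) ≤ ((∑ m, pX S T (vp v (Ls m)) : ℕ) : ℝ)).card : ℝ) ≤
      (Fintype.card (LatinSquare n) : ℝ) ^ d * (8 / n ^ 3) := by
  set s := S.card + T.card with hs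
  have hs0 : (1 : ℝ) ≤ s := by exact_mod_cast h1
  have hsn : (s : ℝ) ≤ n := by exact_mod_cast h2
  have hn0 : (0 : ℝ) < n := by linarith
  have hST : (S.card : ℝ) * T.card ≤ s ^ 2 / 4 := by
    rw [hs]; push_cast; nlinarith [sq_nonneg ((S.card : ℝ) - T.card)]
  have hSTn : (S.card : ℝ) * T.card / n ≤ s ^ 2 / 4 / n := by gcongr
  have hd0 : (0 : ℝ) < d := by rw [hd]; norm_num
  have hN : (0 : ℝ) ≤ (Fintype.card (LatinSquare n) : ℝ) ^ d := by positivity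
  by_cases hl : n < 100 * s
  · have hl' : (n : ℝ) < 100 * s := by exact_mod_cast hl
    have ht : thr n s = 3 / 8 * s := if_pos hl
    have h := vp_tail (d := d) v S T 2 (by norm_num) (d * thr n s)
    refine (mul_le_mul choose_heavy h (by positivity) (Real.exp_pos _).le).trans ?_
    rw [mul_left_comm]
    refine mul_le_mul_of_nonneg_left ?_ hN
    rw [← Real.exp_add]
    have hlog := Real.log_two_gt_d9
    have hexp : 2 * (n : ℝ) + (d * ((2 - 1) * S.card * T.card / n) - d * thr n s * Real.log 2) ≤ -(3 * n) := by
      rw [ht]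
      have a1 : ((2 : ℝ) - 1) * S.card * T.card / n ≤ s / 4 := by
        calc ((2 : ℝ) - 1) * S.card * T.card / n = (S.card : ℝ) * T.card / n := by ring
          _ ≤ s ^ 2 / 4 / n := hSTn
          _ ≤ s / 4 := by rw [div_le_iff₀ hn0]; nlinarith
      have a2 : (d : ℝ) * ((2 - 1) * S.card * T.card / n) ≤ d * (s / 4) := mul_le_mul_of_nonneg_left a1 hd0.le
      have a3 : (d : ℝ) * (3 / 8 * s) * 0.6931 ≤ d * (3 / 8 * s) * Real.log 2 :=
        mul_le_mul_of_nonneg_left (by linarith) (by positivity)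
      rw [hd] at a2 a3 ⊢
      linarith
    calc _ ≤ Real.exp (-(3 * n)) := Real.exp_le_exp.2 hexp
      _ = (Real.exp n ^ 3)⁻¹ := by rw [Real.exp_neg, ← Real.exp_nat_mul]; norm_num
      _ ≤ ((n : ℝ) ^ 3)⁻¹ := by
          gcongr
          have := Real.add_one_le_exp (n : ℝ); linarith
      _ ≤ _ := by rw [div_eq_mul_inv]; have : 0 ≤ ((n : ℝ) ^ 3)⁻¹ := by positivity
                  linarith
  · have ht : thr n s = s / 10 := if_neg hl
    push Not at hl
    have hl' : 100 * (s : ℝ) ≤ n := by exact_mod_cast hl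
    have hx : (100 : ℝ) ≤ (n : ℝ) / s := by
      rw [le_div_iff₀ (by linarith)]; exact hl'
    set x := (n : ℝ) / s with hxdef
    have h := vp_tail (d := d) v S T (0.4 * x) (by linarith) (d * thr n s)
    refine (mul_le_mul (choose_light h1 hl) h (by positivity) (Real.exp_pos _).le).trans ?_
    rw [mul_left_comm]
    refine mul_le_mul_of_nonneg_left ?_ hN
    rw [← Real.exp_add, ← hxdef]
    have hlx : 4.5 ≤ Real.log x := by
      rw [Real.le_log_iff_exp_le (by linarith)]
      refine le_trans ?_ hx
      have : Real.exp 4.5 = (Real.exp 1) ^ 4 * Real.exp 0.5 := by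
        rw [← Real.exp_nat_mul, ← Real.exp_add]; norm_num
      have h5 : Real.exp 0.5 * Real.exp 0.5 = Real.exp 1 := by rw [← Real.exp_add]; norm_num
      have h6 := Real.exp_one_lt_d9
      have h8 := Real.exp_pos 1
      have h7 : Real.exp 0.5 ≤ 1.65 := by
        by_contra hc; push Not at hc; nlinarith
      rw [this]
      have h9 : Real.exp 1 ^ 2 ≤ 7.4 := by nlinarith
      have h10 : Real.exp 1 ^ 4 ≤ 55 := by
        have : Real.exp 1 ^ 4 = Real.exp 1 ^ 2 * Real.exp 1 ^ 2 := by ring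
        rw [this]; nlinarith [sq_nonneg (Real.exp 1)]
      calc _ ≤ 55 * (1.65 : ℝ) := mul_le_mul h10 h7 (Real.exp_pos _).le (by norm_num)
        _ ≤ 100 := by norm_num
    have hl4 : Real.log (0.4 * x) ≥ Real.log x - 1 := by
      rw [Real.log_mul (by norm_num) (by linarith)]
      have : -1 ≤ Real.log 0.4 := by
        rw [Real.le_log_iff_exp_le (by norm_num), Real.exp_neg, inv_le_comm₀ (Real.exp_pos _) (by norm_num)]
        have := Real.exp_one_gt_d9
        norm_num; linarith
      linarith
    have hexp : (s : ℝ) * (2 * Real.log x) + (d * ((0.4 * x - 1) * S.card * T.card / n) -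
        d * thr n s * Real.log (0.4 * x)) ≤ 3 * (-(s * Real.log x)) := by
      rw [ht]
      have a1 : (0.4 * x - 1) * S.card * T.card / n ≤ 0.1 * s := by
        calc (0.4 * x - 1) * S.card * T.card / n = (0.4 * x - 1) * ((S.card : ℝ) * T.card / n) := by ring
          _ ≤ (0.4 * x) * (s ^ 2 / 4 / n) := mul_le_mul (by linarith) hSTn (by positivity) (by linarith)
          _ = 0.1 * s := by rw [hxdef]; field_simp; norm_num
      have a2 : (d : ℝ) * ((0.4 * x - 1) * S.card * T.card / n) ≤ d * (0.1 * s) :=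
        mul_le_mul_of_nonneg_left a1 hd0.le
      have a3 : (d : ℝ) * (s / 10) * (Real.log x - 1) ≤ d * (s / 10) * Real.log (0.4 * x) :=
        mul_le_mul_of_nonneg_left hl4 (by positivity)
      have a4 : (s : ℝ) * 4.5 ≤ s * Real.log x := mul_le_mul_of_nonneg_left hlx (by linarith)
      rw [hd] at a2 a3 ⊢
      nlinarith
    calc _ ≤ Real.exp (3 * (-(s * Real.log x))) := Real.exp_le_exp.2 hexp
      _ = (Real.exp (-(s * Real.log x))) ^ 3 := by rw [← Real.exp_nat_mul]; norm_num
      _ ≤ (2 / n) ^ 3 := by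
          apply pow_le_pow_left₀ (Real.exp_pos _).le
          exact pow_light h1 hl
      _ = _ := by rw [div_pow]; norm_num

def goodE {n d : ℕ} (Ls : Fin d → LatinSquare n) : Prop :=
  ∀ v : Fin 3 × Fin n, ∀ S T : Finset (Fin n), 1 ≤ S.card + T.card → S.card + T.card ≤ n →
    ((∑ m, pX S T (vp v (Ls m)) : ℕ) : ℝ) ≤ d * thr n (S.card + T.card)

lemma goodE_prob {n d : ℕ} (hn : 1 ≤ n) (hd : (d : ℝ) = 10 ^ 11) :
    ((univ.filter fun Ls : Fin d → LatinSquare n => ¬ goodE Ls).card : ℝ) ≤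
      (Fintype.card (LatinSquare n) : ℝ) ^ d * (24 / n) := by
  have hn0 : (0 : ℝ) < n := by exact_mod_cast hn
  let bad : (Fin 3 × Fin n) → Finset (Fin n ⊕ Fin n) → Finset (Fin d → LatinSquare n) := fun v U =>
    univ.filter fun Ls => d * thr n (U.toLeft.card + U.toRight.card) ≤
      ((∑ m, pX U.toLeft U.toRight (vp v (Ls m)) : ℕ) : ℝ)
  have hsub : (univ.filter fun Ls : Fin d → LatinSquare n => ¬ goodE Ls) ⊆
      (univ : Finset (Fin 3 × Fin n)).biUnion fun v => (Finset.Icc 1 n).biUnion fun s =>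
        ((univ : Finset (Fin n ⊕ Fin n)).powersetCard s).biUnion fun U => bad v U := by
    intro Ls h
    rw [Finset.mem_filter] at h
    have h := h.2
    unfold goodE at h
    push Not at h
    obtain ⟨v, S, T, h1, h2, h3⟩ := h
    simp only [Finset.mem_biUnion, Finset.mem_univ, true_and]
    refine ⟨v, S.card + T.card, Finset.mem_Icc.2 ⟨h1, h2⟩, S.disjSum T, ?_, ?_⟩
    · rw [Finset.mem_powersetCard]
      exact ⟨Finset.subset_univ _, Finset.card_disjSum _ _⟩
    · simp only [bad, Finset.mem_filter, Finset.mem_univ, true_and, Finset.toLeft_disjSum, Finset.toRight_disjSum]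
      exact h3.le
  set N := (Fintype.card (LatinSquare n) : ℝ) ^ d with hN
  have hN0 : 0 ≤ N := by positivity
  have hU : ∀ v, ∀ s ∈ Finset.Icc 1 n,
      ((((univ : Finset (Fin n ⊕ Fin n)).powersetCard s).biUnion fun U => bad v U).card : ℝ) ≤ N * (8 / n ^ 3) := by
    intro v s hs
    rw [Finset.mem_Icc] at hs
    have hcard : ((univ : Finset (Fin n ⊕ Fin n)).powersetCard s).card = (2 * n).choose s := by
      rw [Finset.card_powersetCard, Finset.card_univ, Fintype.card_sum, Fintype.card_fin, two_mul]
    have hpos : (0 : ℝ) < (2 * n).choose s := by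
      exact_mod_cast Nat.choose_pos (by omega)
    calc _ ≤ ((∑ U ∈ (univ : Finset (Fin n ⊕ Fin n)).powersetCard s, (bad v U).card : ℕ) : ℝ) := by
          exact_mod_cast Finset.card_biUnion_le
      _ ≤ ∑ U ∈ (univ : Finset (Fin n ⊕ Fin n)).powersetCard s, (N * (8 / n ^ 3)) / (2 * n).choose s := by
          rw [Nat.cast_sum]
          refine Finset.sum_le_sum fun U hU => ?_
          rw [Finset.mem_powersetCard] at hU
          have hUc : U.toLeft.card + U.toRight.card = s := by
            rw [Finset.card_toLeft_add_card_toRight]; exact hU.2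
          have := bad_prob hd v U.toLeft U.toRight (by omega) (by omega)
          rw [le_div_iff₀ hpos, mul_comm]
          rw [hUc] at this
          simp only [bad, hUc]
          exact this
      _ = _ := by
          rw [Finset.sum_const, hcard, nsmul_eq_mul]
          field_simp
  calc _ ≤ (((univ : Finset (Fin 3 × Fin n)).biUnion fun v => (Finset.Icc 1 n).biUnion fun s =>
        ((univ : Finset (Fin n ⊕ Fin n)).powersetCard s).biUnion fun U => bad v U).card : ℝ) := by
        exact_mod_cast Finset.card_le_card hsub
    _ ≤ ∑ v : Fin 3 × Fin n, ∑ s ∈ Finset.Icc 1 n,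
        ((((univ : Finset (Fin n ⊕ Fin n)).powersetCard s).biUnion fun U => bad v U).card : ℝ) := by
        have h1 := Finset.card_biUnion_le (s := (univ : Finset (Fin 3 × Fin n))) (t := fun v => (Finset.Icc 1 n).biUnion fun s =>
          ((univ : Finset (Fin n ⊕ Fin n)).powersetCard s).biUnion fun U => bad v U)
        have h2 := h1.trans (Finset.sum_le_sum fun v _ => Finset.card_biUnion_le (s := Finset.Icc 1 n) (t := fun s =>
          ((univ : Finset (Fin n ⊕ Fin n)).powersetCard s).biUnion fun U => bad v U))
        exact_mod_cast h2
    _ ≤ ∑ v : Fin 3 × Fin n, ∑ s ∈ Finset.Icc 1 n, N * (8 / n ^ 3) :=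
        Finset.sum_le_sum fun v _ => Finset.sum_le_sum fun s hs => hU v s hs
    _ = _ := by
        simp only [Finset.sum_const, Finset.card_univ, Fintype.card_prod, Fintype.card_fin, nsmul_eq_mul,
          Nat.card_Icc]
        push_cast
        field_simp
        ring

def zi (a : ZMod 2) : ℕ := if a ≠ 0 then 1 else 0

lemma zmod2_cases (a : ZMod 2) : a = 0 ∨ a = 1 := by
  revert a; decide

lemma zi_zero : zi 0 = 0 := by simp [zi]
lemma zi_one : zi 1 = 1 := by simp [zi]
lemma zi_le (a : ZMod 2) : zi a ≤ 1 := by unfold zi; split_ifs <;> omega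

lemma zi_three (a b c : ZMod 2) :
    zi a + zi b + zi c ≤ zi (a + b + c) + 2 * (zi a * zi b + zi a * zi c + zi b * zi c) := by
  have h2 : (1 : ZMod 2) + 1 = 0 := by decide
  rcases zmod2_cases a with rfl | rfl <;> rcases zmod2_cases b with rfl | rfl <;>
    rcases zmod2_cases c with rfl | rfl <;> simp [zi_zero, zi_one, h2]

lemma zi_flip (a : ZMod 2) : zi (a + 1) + 2 * zi a = zi a + 1 := by
  have h2 : (1 : ZMod 2) + 1 = 0 := by decide
  rcases zmod2_cases a with rfl | rfl <;> simp [zi_zero, zi_one, h2]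

lemma zi_card {α : Type*} [Fintype α] (f : α → ZMod 2) : (univ.filter fun p => f p ≠ 0).card = ∑ p, zi (f p) := by
  rw [Finset.card_filter]; rfl

lemma norm1_sum {n : ℕ} (φ : Cochain1 n) : norm1 φ = ∑ i, ∑ j, zi (φ.ab i j) +
    ∑ i, ∑ k, zi (φ.ac i k) + ∑ j, ∑ k, zi (φ.bc j k) := by
  unfold norm1
  have h : ∀ f : Fin n → Fin n → ZMod 2,
      (univ.filter fun p : Fin n × Fin n => f p.1 p.2 ≠ 0).card = ∑ i, ∑ j, zi (f i j) := by
    intro f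
    have := zi_card (fun p : Fin n × Fin n => f p.1 p.2)
    rw [Fintype.sum_prod_type] at this
    rw [← this]
  rw [h, h, h]

def cS {n : ℕ} (φ : Cochain1 n) (v : Fin 3 × Fin n) : Finset (Fin n) :=
  if v.1 = 0 then univ.filter fun j => φ.ab v.2 j ≠ 0
  else if v.1 = 1 then univ.filter fun i => φ.ab i v.2 ≠ 0
  else univ.filter fun i => φ.ac i v.2 ≠ 0

def cT {n : ℕ} (φ : Cochain1 n) (v : Fin 3 × Fin n) : Finset (Fin n) :=
  if v.1 = 0 then univ.filter fun k => φ.ac v.2 k ≠ 0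
  else if v.1 = 1 then univ.filter fun k => φ.bc v.2 k ≠ 0
  else univ.filter fun j => φ.bc j v.2 ≠ 0

def sv {n : ℕ} (φ : Cochain1 n) (v : Fin 3 × Fin n) : ℕ := (cS φ v).card + (cT φ v).card

lemma sv0 {n : ℕ} (φ : Cochain1 n) (i : Fin n) : sv φ (0, i) = ∑ j, zi (φ.ab i j) + ∑ k, zi (φ.ac i k) := by
  simp only [sv, cS, cT, if_true, zi_card]
lemma sv1 {n : ℕ} (φ : Cochain1 n) (j : Fin n) : sv φ (1, j) = ∑ i, zi (φ.ab i j) + ∑ k, zi (φ.bc j k) := by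
  simp only [sv, cS, cT, if_true, one_ne_zero, if_false, zi_card]
lemma sv2 {n : ℕ} (φ : Cochain1 n) (k : Fin n) : sv φ (2, k) = ∑ i, zi (φ.ac i k) + ∑ j, zi (φ.bc j k) := by
  have h1 : (2 : Fin 3) ≠ 0 := by decide
  have h2 : (2 : Fin 3) ≠ 1 := by decide
  simp only [sv, cS, cT, h1, h2, if_false, zi_card]

lemma sum_v {n : ℕ} {M : Type*} [AddCommMonoid M] (f : Fin 3 × Fin n → M) :
    ∑ v, f v = ∑ i, f (0, i) + ∑ j, f (1, j) + ∑ k, f (2, k) := by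
  rw [Fintype.sum_prod_type, Fin.sum_univ_three]

lemma sv_weight {n : ℕ} (φ : Cochain1 n) (u : Fin 3 × Fin n → ℕ) :
    ∑ v, u v * sv φ v = ∑ i, ∑ j, (u (0, i) + u (1, j)) * zi (φ.ab i j) +
      ∑ i, ∑ k, (u (0, i) + u (2, k)) * zi (φ.ac i k) + ∑ j, ∑ k, (u (1, j) + u (2, k)) * zi (φ.bc j k) := by
  rw [sum_v]
  simp only [sv0, sv1, sv2, add_mul, mul_add, Finset.sum_add_distrib, Finset.mul_sum]
  rw [Finset.sum_comm (f := fun j i => u (1, j) * zi (φ.ab i j)),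
    Finset.sum_comm (f := fun k i => u (2, k) * zi (φ.ac i k)),
    Finset.sum_comm (f := fun k j => u (2, k) * zi (φ.bc j k))]
  ring

lemma sv_total {n : ℕ} (φ : Cochain1 n) : ∑ v, sv φ v = 2 * norm1 φ := by
  have := sv_weight φ (fun _ => 1)
  simp only [one_mul] at this
  rw [this, norm1_sum]
  simp only [← Finset.mul_sum]
  ring

lemma sv_heavy {n : ℕ} (φ : Cochain1 n) (u : Fin 3 × Fin n → ℕ) (hu : ∀ v, u v = 0 ∨ u v = 1) :
    ∑ v, u v * sv φ v ≤ norm1 φ + (∑ v, u v) ^ 2 := by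
  have key : ∀ (a b : Fin 3 × Fin n) (x : ZMod 2), (u a + u b) * zi x ≤ zi x + u a * u b := by
    intro a b x
    have := zi_le x
    rcases hu a with ha | ha <;> rcases hu b with hb | hb <;> rw [ha, hb] <;> omega
  rw [sv_weight, norm1_sum, sum_v]
  have h1 : ∑ i, ∑ j, (u (0, i) + u (1, j)) * zi (φ.ab i j) ≤ ∑ i, ∑ j, zi (φ.ab i j) +
      (∑ i, u (0, i)) * (∑ j, u (1, j)) := by
    rw [Finset.sum_mul_sum]; simp only [← Finset.sum_add_distrib]
    exact Finset.sum_le_sum fun i _ => Finset.sum_le_sum fun j _ => key _ _ _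
  have h2 : ∑ i, ∑ k, (u (0, i) + u (2, k)) * zi (φ.ac i k) ≤ ∑ i, ∑ k, zi (φ.ac i k) +
      (∑ i, u (0, i)) * (∑ j, u (2, j)) := by
    rw [Finset.sum_mul_sum]; simp only [← Finset.sum_add_distrib]
    exact Finset.sum_le_sum fun i _ => Finset.sum_le_sum fun j _ => key _ _ _
  have h3 : ∑ j, ∑ k, (u (1, j) + u (2, k)) * zi (φ.bc j k) ≤ ∑ j, ∑ k, zi (φ.bc j k) +
      (∑ i, u (1, i)) * (∑ j, u (2, j)) := by
    rw [Finset.sum_mul_sum]; simp only [← Finset.sum_add_distrib]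
    exact Finset.sum_le_sum fun i _ => Finset.sum_le_sum fun j _ => key _ _ _
  nlinarith [Nat.zero_le ((∑ i, u (0, i)) * (∑ j, u (1, j))), Nat.zero_le ((∑ i, u (0, i)) * (∑ j, u (2, j))),
    Nat.zero_le ((∑ i, u (1, i)) * (∑ j, u (2, j))), Nat.zero_le ((∑ i, u (0, i)) ^ 2),
    Nat.zero_le ((∑ i, u (1, i)) ^ 2), Nat.zero_le ((∑ i, u (2, i)) ^ 2)]

lemma sum_flip_fst {n : ℕ} (f : Fin n → Fin n → ZMod 2) (a : Fin n) :
    ∑ i, ∑ j, zi (f i j + if i = a then 1 else 0) + 2 * ∑ j, zi (f a j) = ∑ i, ∑ j, zi (f i j) + n := by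
  have h : ∀ i, ∑ j, zi (f i j + if i = a then 1 else 0) + (if i = a then 2 * ∑ j, zi (f a j) else 0)
      = ∑ j, zi (f i j) + if i = a then n else 0 := by
    intro i
    by_cases h : i = a
    · subst h
      simp only [if_true]
      rw [Finset.mul_sum, ← Finset.sum_add_distrib]
      simp only [zi_flip, Finset.sum_add_distrib]
      simp
    · simp [h]
  have h2 := Finset.sum_congr (rfl : (univ : Finset (Fin n)) = univ) fun i _ => h i
  simp only [Finset.sum_add_distrib] at h2
  simpa using h2

lemma sum_flip_snd {n : ℕ} (f : Fin n → Fin n → ZMod 2) (a : Fin n) :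
    ∑ i, ∑ j, zi (f i j + if j = a then 1 else 0) + 2 * ∑ i, zi (f i a) = ∑ i, ∑ j, zi (f i j) + n := by
  have := sum_flip_fst (fun j i => f i j) a
  rw [Finset.sum_comm] at this
  rw [this, Finset.sum_comm]

lemma flip_norm {n : ℕ} (φ : Cochain1 n) (v : Fin 3 × Fin n) :
    norm1 (φ + d0 (fun v' => if v' = v then 1 else 0)) + 2 * sv φ v = norm1 φ + 2 * n := by
  obtain ⟨c, a⟩ := v
  rw [norm1_sum, norm1_sum]
  have e1 : ∀ ψ : Fin 3 × Fin n → ZMod 2, ∀ i j, (φ + d0 ψ).ab i j = φ.ab i j + (ψ (0, i) + ψ (1, j)) := fun _ _ _ => rfl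
  have e2 : ∀ ψ : Fin 3 × Fin n → ZMod 2, ∀ i j, (φ + d0 ψ).ac i j = φ.ac i j + (ψ (0, i) + ψ (2, j)) := fun _ _ _ => rfl
  have e3 : ∀ ψ : Fin 3 × Fin n → ZMod 2, ∀ i j, (φ + d0 ψ).bc i j = φ.bc i j + (ψ (1, i) + ψ (2, j)) := fun _ _ _ => rfl
  simp only [e1, e2, e3, Prod.mk.injEq]
  have hc : c = 0 ∨ c = 1 ∨ c = 2 := by revert c; decide
  rcases hc with rfl | rfl | rfl
  · rw [sv0]
    have h1 := sum_flip_fst φ.ab a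
    have h2 := sum_flip_fst φ.ac a
    simp only [true_and, show ((1 : Fin 3) = 0) = False by decide, show ((2 : Fin 3) = 0) = False by decide,
      false_and, if_false, add_zero]
    omega
  · rw [sv1]
    have h1 := sum_flip_snd φ.ab a
    have h2 := sum_flip_fst φ.bc a
    simp only [true_and, show ((0 : Fin 3) = 1) = False by decide, show ((2 : Fin 3) = 1) = False by decide,
      false_and, if_false, add_zero, zero_add]
    omega
  · rw [sv2]
    have h1 := sum_flip_snd φ.ac a
    have h2 := sum_flip_snd φ.bc a
    simp only [true_and, show ((0 : Fin 3) = 2) = False by decide, show ((1 : Fin 3) = 2) = False by decide,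
      false_and, if_false, add_zero, zero_add]
    omega

def Dset {n : ℕ} (φ : Cochain1 n) : Finset (Fin n × Fin n × Fin n) :=
  univ.filter fun t => d1 φ t.1 t.2.1 t.2.2 ≠ 0

lemma hit_sum {n : ℕ} (φ : Cochain1 n) (L : LatinSquare n) :
    hitE (Dset φ) L = ∑ i, ∑ j, zi (d1 φ i j (L.1 i j)) := by
  unfold hitE Dset
  simp only [Finset.mem_filter, Finset.mem_univ, true_and]
  rw [zi_card (fun c : Fin n × Fin n => d1 φ c.1 c.2 (L.1 c.1 c.2)), Fintype.sum_prod_type]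

lemma hit_le {n d : ℕ} (φ : Cochain1 n) (Ls : Fin d → LatinSquare n) (m : Fin d) :
    hitE (Dset φ) (Ls m) ≤ normd1 (triangles Ls) φ := by
  unfold hitE normd1 triangles Dset
  apply Finset.card_le_card_of_injOn (fun c => (c.1, c.2, (Ls m).1 c.1 c.2))
  · intro c hc
    simp only [Finset.coe_filter, Finset.mem_filter, Finset.mem_univ, true_and, Set.mem_setOf_eq] at hc ⊢
    exact ⟨⟨m, rfl⟩, hc⟩
  · rintro ⟨a, b⟩ _ ⟨a', b'⟩ _ h
    simp only [Prod.mk.injEq] at h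
    rw [h.1, h.2.1]

lemma pX_sum {n : ℕ} (f g : Fin n → ZMod 2) (σ : Equiv.Perm (Fin n)) :
    pX (univ.filter fun j => f j ≠ 0) (univ.filter fun j => g j ≠ 0) σ = ∑ j, zi (f j) * zi (g (σ j)) := by
  unfold pX
  rw [Finset.filter_filter, Finset.card_filter]
  refine Finset.sum_congr rfl fun j _ => ?_
  simp only [Finset.mem_filter, Finset.mem_univ, true_and, zi]
  by_cases h1 : f j = 0 <;> by_cases h2 : g (σ j) = 0 <;> simp [h1, h2]

lemma small_one {n : ℕ} (φ : Cochain1 n) (L : LatinSquare n) :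
    norm1 φ ≤ hitE (Dset φ) L + 2 * ∑ v, pX (cS φ v) (cT φ v) (vp v L) := by
  have p0 : ∀ i, pX (cS φ (0, i)) (cT φ (0, i)) (vp (0, i) L) = ∑ j, zi (φ.ab i j) * zi (φ.ac i (L.1 i j)) := by
    intro i
    simp only [cS, cT, vp, if_true]
    exact pX_sum _ _ _
  have p1 : ∀ j, pX (cS φ (1, j)) (cT φ (1, j)) (vp (1, j) L) = ∑ i, zi (φ.ab i j) * zi (φ.bc j (L.1 i j)) := by
    intro j
    simp only [cS, cT, vp, if_true, one_ne_zero, if_false]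
    exact pX_sum _ _ _
  have p2 : ∀ k, pX (cS φ (2, k)) (cT φ (2, k)) (vp (2, k) L) =
      ∑ i, zi (φ.ac i k) * zi (φ.bc ((L.1 i).symm k) k) := by
    intro k
    have h1 : (2 : Fin 3) ≠ 0 := by decide
    have h2 : (2 : Fin 3) ≠ 1 := by decide
    simp only [cS, cT, vp, h1, h2, if_false]
    exact pX_sum (fun i => φ.ac i k) (fun j => φ.bc j k) (symPerm L k)
  have q2 : ∑ k, ∑ i, zi (φ.ac i k) * zi (φ.bc ((L.1 i).symm k) k) =
      ∑ i, ∑ j, zi (φ.ac i (L.1 i j)) * zi (φ.bc j (L.1 i j)) := by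
    rw [Finset.sum_comm]
    refine Finset.sum_congr rfl fun i _ => ?_
    rw [← Equiv.sum_comp (L.1 i)]
    simp
  have q1 : ∑ j, ∑ i, zi (φ.ab i j) * zi (φ.bc j (L.1 i j)) =
      ∑ i, ∑ j, zi (φ.ab i j) * zi (φ.bc j (L.1 i j)) := Finset.sum_comm
  have n1 : ∑ i, ∑ k, zi (φ.ac i k) = ∑ i, ∑ j, zi (φ.ac i (L.1 i j)) := by
    refine Finset.sum_congr rfl fun i _ => ?_
    rw [← Equiv.sum_comp (L.1 i)]
  have n2 : ∑ j, ∑ k, zi (φ.bc j k) = ∑ i, ∑ j, zi (φ.bc j (L.1 i j)) := by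
    rw [Finset.sum_comm (f := fun i j => zi (φ.bc j (L.1 i j)))]
    refine Finset.sum_congr rfl fun j _ => ?_
    rw [← Equiv.sum_comp (colPerm L j)]
    rfl
  rw [norm1_sum, hit_sum, sum_v]
  simp only [p0, p1, p2]
  rw [q2, q1, n1, n2]
  simp only [← Finset.sum_add_distrib, Finset.mul_sum]
  exact Finset.sum_le_sum fun i _ => Finset.sum_le_sum fun j _ => zi_three _ _ _

lemma small_main {n d : ℕ} (hn : 1 ≤ n) (hd : 0 < d) (Ls : Fin d → LatinSquare n) (hg : goodE Ls)
    (φ : Cochain1 n) (hmin : ∀ ψ, norm1 φ ≤ norm1 (φ + d0 ψ))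
    (hsmall : (norm1 φ : ℝ) ≤ 1 / 10 ^ 6 * n ^ 2) :
    0.028 * (norm1 φ : ℝ) ≤ normd1 (triangles Ls) φ := by
  have hn0 : (0 : ℝ) < n := by exact_mod_cast hn
  have hd0 : (0 : ℝ) < d := by exact_mod_cast hd
  have hsv : ∀ v, sv φ v ≤ n := by
    intro v
    have h1 := flip_norm φ v
    have h2 := hmin (fun v' => if v' = v then 1 else 0)
    omega
  let u : Fin 3 × Fin n → ℕ := fun v => if n < 100 * sv φ v then 1 else 0
  have hu : ∀ v, u v = 0 ∨ u v = 1 := fun v => by simp only [u]; split_ifs <;> simp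
  have hH := sv_heavy φ u hu
  have hcount : n * ∑ v, u v ≤ 200 * norm1 φ := by
    have : 200 * norm1 φ = ∑ v, 100 * sv φ v := by rw [← Finset.mul_sum, sv_total]; ring
    rw [this, Finset.mul_sum]
    refine Finset.sum_le_sum fun v _ => ?_
    simp only [u]; split_ifs with h <;> omega
  have he : ∀ v, ((∑ m, pX (cS φ v) (cT φ v) (vp v (Ls m)) : ℕ) : ℝ) ≤
      d * ((sv φ v : ℝ) / 10 + 0.275 * ((u v * sv φ v : ℕ) : ℝ)) := by
    intro v
    rcases Nat.eq_zero_or_pos (sv φ v) with h0 | h0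
    · have hS : cS φ v = ∅ := by
        rw [← Finset.card_eq_zero]; unfold sv at h0; omega
      rw [hS, h0]; simp [pX]
    · have h := hg v (cS φ v) (cT φ v) h0 (hsv v)
      refine h.trans ?_
      refine mul_le_mul_of_nonneg_left ?_ hd0.le
      change thr n (sv φ v) ≤ _
      simp only [thr, u]
      split_ifs with hh
      · push_cast; linarith
      · simp
  have hsum : (d : ℝ) * norm1 φ ≤ d * normd1 (triangles Ls) φ +
      2 * ∑ v, ((∑ m, pX (cS φ v) (cT φ v) (vp v (Ls m)) : ℕ) : ℝ) := by
    have h1 : ∑ m : Fin d, norm1 φ ≤ ∑ m : Fin d, (normd1 (triangles Ls) φ +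
        2 * ∑ v, pX (cS φ v) (cT φ v) (vp v (Ls m))) := by
      refine Finset.sum_le_sum fun m _ => ?_
      have := small_one φ (Ls m)
      have := hit_le φ Ls m
      omega
    rw [Finset.sum_add_distrib, ← Finset.mul_sum, Finset.sum_comm] at h1
    simp only [Finset.sum_const, Finset.card_univ, Fintype.card_fin, smul_eq_mul] at h1
    exact_mod_cast h1
  have hsum2 : ∑ v, ((∑ m, pX (cS φ v) (cT φ v) (vp v (Ls m)) : ℕ) : ℝ) ≤
      d * (((2 * norm1 φ : ℕ) : ℝ) / 10 + 0.275 * ((∑ v, u v * sv φ v : ℕ) : ℝ)) := by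
    refine (Finset.sum_le_sum fun v _ => he v).trans (le_of_eq ?_)
    rw [← Finset.mul_sum, Finset.sum_add_distrib, ← Finset.sum_div, ← Finset.mul_sum, ← sv_total,
      Nat.cast_sum, Nat.cast_sum]
  set X := (norm1 φ : ℝ) with hX
  have hX0 : 0 ≤ X := Nat.cast_nonneg _
  set h := ((∑ v, u v : ℕ) : ℝ) with hh
  have hh0 : 0 ≤ h := Nat.cast_nonneg _
  have hc2 : (n : ℝ) * h ≤ 200 * X := by rw [hh, hX]; exact_mod_cast hcount
  have hH2 : ((∑ v, u v * sv φ v : ℕ) : ℝ) ≤ X + h ^ 2 := by rw [hh, hX]; exact_mod_cast hH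
  have hsq : h ^ 2 ≤ 0.04 * X := by
    have h1 : (n * h) ^ 2 ≤ (200 * X) ^ 2 := pow_le_pow_left₀ (by positivity) hc2 2
    have h2 : X * X ≤ X * (1 / 10 ^ 6 * n ^ 2) := mul_le_mul_of_nonneg_left hsmall hX0
    have h3 : (0 : ℝ) < n ^ 2 := by positivity
    have h4 : (n : ℝ) ^ 2 * h ^ 2 ≤ n ^ 2 * (0.04 * X) := by nlinarith
    exact le_of_mul_le_mul_left h4 h3
  have hfin : (d : ℝ) * X ≤ d * (normd1 (triangles Ls) φ + 0.972 * X) := by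
    have h5 : (d : ℝ) * (((2 * norm1 φ : ℕ) : ℝ) / 10 + 0.275 * ((∑ v, u v * sv φ v : ℕ) : ℝ)) ≤ d * (0.486 * X) := by
      refine mul_le_mul_of_nonneg_left ?_ hd0.le
      push_cast at hH2 ⊢
      rw [← hX]
      linarith
    have h6 : (d : ℝ) * (normd1 (triangles Ls) φ + 0.972 * X) =
      d * normd1 (triangles Ls) φ + 2 * (d * (0.486 * X)) := by ring
    rw [h6]
    linarith
  have := le_of_mul_le_mul_left hfin hd0
  linarith
end SmallE

lemma cone_le {n : ℕ} (φ : Cochain1 n) (i0 j0 k0 : Fin n) :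
    normClass1 φ ≤ ∑ i, ∑ j, zi (d1 φ i j k0) +
      ∑ i, ∑ k, (zi (d1 φ i j0 k0) + zi (d1 φ i j0 k) + zi (d1 φ i0 j0 k0) + zi (d1 φ i0 j0 k)) +
      ∑ j, ∑ k, (zi (d1 φ i0 j k) + zi (d1 φ i0 j k0)) := by
  have hadd : ∀ a b : ZMod 2, zi (a + b) ≤ zi a + zi b := by decide +revert
  let ψ : Fin 3 × Fin n → ZMod 2 := fun v =>
    if v.1 = 0 then φ.ac v.2 k0 else if v.1 = 1 then φ.bc v.2 k0 else φ.ac i0 v.2 + φ.ac i0 k0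
  have h : normClass1 φ ≤ norm1 (φ + d0 ψ) := Nat.sInf_le ⟨ψ, rfl⟩
  refine h.trans ?_
  rw [norm1_sum]
  have p0 : ∀ i, ψ (0, i) = φ.ac i k0 := fun i => by simp [ψ]
  have p1 : ∀ i, ψ (1, i) = φ.bc i k0 := fun i => by simp [ψ]
  have p2 : ∀ i, ψ (2, i) = φ.ac i0 i + φ.ac i0 k0 := fun i => by
    simp [ψ]
  have t2 : (2 : ZMod 2) = 0 := by decide
  refine add_le_add (add_le_add ?_ ?_) ?_
  · refine Finset.sum_le_sum fun i _ => Finset.sum_le_sum fun j _ => le_of_eq ?_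
    have : (φ + d0 ψ).ab i j = φ.ab i j + (ψ (0, i) + ψ (1, j)) := rfl
    rw [this, p0, p1, d1, add_assoc]
  · refine Finset.sum_le_sum fun i _ => Finset.sum_le_sum fun k _ => ?_
    have e : (φ + d0 ψ).ac i k = φ.ac i k + (ψ (0, i) + ψ (2, k)) := rfl
    have e2 : (φ + d0 ψ).ac i k = d1 φ i j0 k0 + d1 φ i j0 k + d1 φ i0 j0 k0 + d1 φ i0 j0 k := by
      rw [e, p0, p2]; simp only [d1]
      linear_combination (-φ.ab i j0 - φ.ab i0 j0 - φ.bc j0 k0 - φ.bc j0 k) * t2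
    rw [e2]
    exact (hadd _ _).trans (add_le_add_left ((hadd _ _).trans (add_le_add_left (hadd _ _) _)) _)
  · refine Finset.sum_le_sum fun j _ => Finset.sum_le_sum fun k _ => ?_
    have e : (φ + d0 ψ).bc j k = φ.bc j k + (ψ (1, j) + ψ (2, k)) := rfl
    have e2 : (φ + d0 ψ).bc j k = d1 φ i0 j k + d1 φ i0 j k0 := by
      rw [e, p1, p2]; simp only [d1]
      linear_combination (-φ.ab i0 j) * t2
    rw [e2]
    exact hadd _ _

lemma Dset_card {n : ℕ} (φ : Cochain1 n) : (Dset φ).card = ∑ i, ∑ j, ∑ k, zi (d1 φ i j k) := by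
  unfold Dset
  rw [zi_card (fun t : Fin n × Fin n × Fin n => d1 φ t.1 t.2.1 t.2.2), Fintype.sum_prod_type]
  refine Finset.sum_congr rfl fun i _ => ?_
  rw [Fintype.sum_prod_type]

lemma cone_sum {n : ℕ} (D : Fin n → Fin n → Fin n → ℕ) :
    ∑ i0, ∑ j0, ∑ k0, (∑ i, ∑ j, D i j k0 +
      ∑ i, ∑ k, (D i j0 k0 + D i j0 k + D i0 j0 k0 + D i0 j0 k) +
      ∑ j, ∑ k, (D i0 j k + D i0 j k0)) = 7 * n ^ 2 * ∑ i, ∑ j, ∑ k, D i j k := by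
  have c1 : ∑ k, ∑ i, ∑ j, D i j k = ∑ i, ∑ j, ∑ k, D i j k := by
    rw [Finset.sum_comm]; exact Finset.sum_congr rfl fun i _ => Finset.sum_comm
  have c2 : ∑ j, ∑ k, ∑ i, D i j k = ∑ i, ∑ j, ∑ k, D i j k := by
    rw [Finset.sum_comm (f := fun i j => ∑ k, D i j k)]
    exact Finset.sum_congr rfl fun i _ => Finset.sum_comm
  have c3 : ∑ j, ∑ i, ∑ k, D i j k = ∑ i, ∑ j, ∑ k, D i j k := Finset.sum_comm
  have c7 : ∑ i, ∑ k, ∑ j, D i j k = ∑ i, ∑ j, ∑ k, D i j k :=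
    Finset.sum_congr rfl fun i _ => Finset.sum_comm
  simp only [Finset.sum_add_distrib, Finset.sum_const, Finset.card_univ, Fintype.card_fin, smul_eq_mul,
    ← Finset.mul_sum, c1, c2, c3, c7]
  ring

lemma Dset_large {n : ℕ} (hn : 0 < n) (φ : Cochain1 n) : n * normClass1 φ ≤ 7 * (Dset φ).card := by
  have h : ∑ _i0 : Fin n, ∑ _j0 : Fin n, ∑ _k0 : Fin n, normClass1 φ ≤ _ :=
    Finset.sum_le_sum fun i0 _ => Finset.sum_le_sum fun j0 _ => Finset.sum_le_sum fun k0 _ => cone_le φ i0 j0 k0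
  rw [cone_sum (fun i j k => zi (d1 φ i j k)), ← Dset_card] at h
  simp only [Finset.sum_const, Finset.card_univ, Fintype.card_fin, smul_eq_mul] at h
  have h2 : n ^ 2 * (n * normClass1 φ) ≤ n ^ 2 * (7 * (Dset φ).card) := by
    calc _ = n * (n * (n * normClass1 φ)) := by ring
      _ ≤ _ := h
      _ = _ := by ring
  exact Nat.le_of_mul_le_mul_left h2 (by positivity)

lemma large_fixed {n d : ℕ} (hn : 1 ≤ n) (E : Finset (Fin n × Fin n × Fin n)) (r : ℝ) :
    ((univ.filter fun Ls : Fin d → LatinSquare n => ∀ m, (hitE E (Ls m) : ℝ) ≤ r).card : ℝ) ≤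
      (Fintype.card (LatinSquare n) : ℝ) ^ d *
        Real.exp (d * (r + 18 * (n * Real.sqrt n) - (E.card : ℝ) / (2 * n))) := by
  have hr : ∀ h : ℕ, (h : ℝ) ≤ r → 1 ≤ Real.exp r * (1 / 2 : ℝ) ^ h := by
    intro h hh
    have h1 : (2 : ℝ) ^ h ≤ Real.exp r := by
      calc (2 : ℝ) ^ h ≤ (Real.exp 1) ^ h := by
            refine pow_le_pow_left₀ (by norm_num) ?_ h
            have := Real.add_one_le_exp (1 : ℝ); linarith
        _ = Real.exp h := by rw [← Real.exp_nat_mul, mul_one]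
        _ ≤ _ := Real.exp_le_exp.2 hh
    rw [one_div, inv_pow, ← div_eq_mul_inv, le_div_iff₀ (by positivity), one_mul]
    exact h1
  calc ((univ.filter fun Ls : Fin d → LatinSquare n => ∀ m, (hitE E (Ls m) : ℝ) ≤ r).card : ℝ)
      = ∑ Ls : Fin d → LatinSquare n, if ∀ m, (hitE E (Ls m) : ℝ) ≤ r then (1 : ℝ) else 0 := by
        rw [Finset.card_filter]; push_cast; rfl
    _ ≤ ∑ Ls : Fin d → LatinSquare n, ∏ m, (Real.exp r * (1 / 2 : ℝ) ^ hitE E (Ls m)) := by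
        refine Finset.sum_le_sum fun Ls _ => ?_
        split_ifs with h
        · have := Finset.prod_le_prod (s := (univ : Finset (Fin d))) (f := fun _ => (1 : ℝ))
            (g := fun m => Real.exp r * (1 / 2 : ℝ) ^ hitE E (Ls m)) (fun _ _ => zero_le_one) (fun m _ => hr _ (h m))
          simpa using this
        · exact Finset.prod_nonneg fun m _ => by positivity
    _ = (∑ L : LatinSquare n, Real.exp r * (1 / 2 : ℝ) ^ hitE E L) ^ d :=
        sum_pi_pow d (fun L => Real.exp r * (1 / 2 : ℝ) ^ hitE E L)
    _ ≤ (Real.exp r * ((Fintype.card (LatinSquare n) : ℝ) *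
        Real.exp (18 * (n * Real.sqrt n) - (E.card : ℝ) / (2 * n)))) ^ d := by
        refine pow_le_pow_left₀ (Finset.sum_nonneg fun _ _ => by positivity) ?_ d
        rw [← Finset.mul_sum]
        exact mul_le_mul_of_nonneg_left (hit_mgf hn E) (Real.exp_pos _).le
    _ = _ := by
        have : Real.exp r * ((Fintype.card (LatinSquare n) : ℝ) *
          Real.exp (18 * (n * Real.sqrt n) - (E.card : ℝ) / (2 * n))) =
          (Fintype.card (LatinSquare n) : ℝ) * Real.exp (r + 18 * (n * Real.sqrt n) - (E.card : ℝ) / (2 * n)) := by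
          rw [add_sub_assoc, Real.exp_add]; ring
        rw [this, mul_pow, ← Real.exp_nat_mul]

def goodL {n d : ℕ} (Ls : Fin d → LatinSquare n) : Prop :=
  ∀ φ : Cochain1 n, 1 / (7 * 10 ^ 6) * (n : ℝ) ^ 3 < (Dset φ).card →
    6 / 10 ^ 11 * (n : ℝ) ^ 2 < normd1 (triangles Ls) φ

lemma goodL_prob {n d : ℕ} (hn : 1 ≤ n) (hd : (d : ℝ) = 10 ^ 11) (hbig : (10 : ℝ) ^ 10 ≤ Real.sqrt n) :
    ((univ.filter fun Ls : Fin d → LatinSquare n => ¬ goodL Ls).card : ℝ) ≤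
      (Fintype.card (LatinSquare n) : ℝ) ^ d * Real.exp (-(n : ℝ) ^ 2) := by
  have hn0 : (0 : ℝ) < n := by exact_mod_cast hn
  let X := (Fin n → Fin n → ZMod 2) × (Fin n → Fin n → ZMod 2) × (Fin n → Fin n → ZMod 2)
  let mk : X → Cochain1 n := fun x => ⟨x.1, x.2.1, x.2.2⟩
  let r : ℝ := 6 / 10 ^ 11 * (n : ℝ) ^ 2
  let bad : X → Finset (Fin d → LatinSquare n) := fun x =>
    univ.filter fun Ls => ∀ m, (hitE (Dset (mk x)) (Ls m) : ℝ) ≤ r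
  let P : Finset X := univ.filter fun x => 1 / (7 * 10 ^ 6) * (n : ℝ) ^ 3 < (Dset (mk x)).card
  have hsub : (univ.filter fun Ls : Fin d → LatinSquare n => ¬ goodL Ls) ⊆ P.biUnion bad := by
    intro Ls hLs
    rw [Finset.mem_filter] at hLs
    have h := hLs.2
    unfold goodL at h
    push Not at h
    obtain ⟨φ, h1, h2⟩ := h
    rw [Finset.mem_biUnion]
    refine ⟨(φ.ab, φ.ac, φ.bc), ?_, ?_⟩
    · exact Finset.mem_filter.2 ⟨Finset.mem_univ _, h1⟩
    · refine Finset.mem_filter.2 ⟨Finset.mem_univ _, fun m => ?_⟩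
      have h3 := hit_le φ Ls m
      have h4 : (hitE (Dset φ) (Ls m) : ℝ) ≤ normd1 (triangles Ls) φ := by exact_mod_cast h3
      exact h4.trans h2
  have hN : (0 : ℝ) ≤ (Fintype.card (LatinSquare n) : ℝ) ^ d := by positivity
  have hb : ∀ x ∈ P, ((bad x).card : ℝ) ≤ (Fintype.card (LatinSquare n) : ℝ) ^ d * Real.exp (-4 * (n : ℝ) ^ 2) := by
    intro x hx
    refine (large_fixed hn (Dset (mk x)) r).trans ?_
    refine mul_le_mul_of_nonneg_left (Real.exp_le_exp.2 ?_) hN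
    have hP : 1 / (7 * 10 ^ 6) * (n : ℝ) ^ 3 < (Dset (mk x)).card := (Finset.mem_filter.1 hx).2
    have h1 : 1 / (14 * 10 ^ 6) * (n : ℝ) ^ 2 ≤ ((Dset (mk x)).card : ℝ) / (2 * n) := by
      rw [le_div_iff₀ (by positivity)]
      nlinarith
    have h2 : (n : ℝ) * Real.sqrt n * 10 ^ 10 ≤ n ^ 2 := by
      have h3 : Real.sqrt n * Real.sqrt n = n := Real.mul_self_sqrt hn0.le
      have h4 : Real.sqrt n * 10 ^ 10 ≤ n := by
        calc Real.sqrt n * 10 ^ 10 ≤ Real.sqrt n * Real.sqrt n :=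
              mul_le_mul_of_nonneg_left hbig (Real.sqrt_nonneg _)
          _ = n := h3
      calc (n : ℝ) * Real.sqrt n * 10 ^ 10 = n * (Real.sqrt n * 10 ^ 10) := by ring
        _ ≤ (n : ℝ) * n := mul_le_mul_of_nonneg_left h4 hn0.le
        _ = (n : ℝ) ^ 2 := by ring
    rw [hd]
    simp only [r]
    have h5 : (0 : ℝ) ≤ n ^ 2 := by positivity
    linarith
  have hcX : ((Finset.card P : ℕ) : ℝ) ≤ Real.exp (3 * (n : ℝ) ^ 2) := by
    have h1 : P.card ≤ Fintype.card X := Finset.card_le_univ _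
    have h2 : Fintype.card X = 2 ^ (3 * n ^ 2) := by
      simp only [X, Fintype.card_prod, Fintype.card_fun, ZMod.card, Fintype.card_fin]
      rw [← pow_mul, ← pow_add, ← pow_add]
      congr 1; ring
    rw [h2] at h1
    calc ((Finset.card P : ℕ) : ℝ) ≤ (2 : ℝ) ^ (3 * n ^ 2) := by exact_mod_cast h1
      _ ≤ (Real.exp 1) ^ (3 * n ^ 2) := by
          refine pow_le_pow_left₀ (by norm_num) ?_ _
          have := Real.add_one_le_exp (1 : ℝ); linarith
      _ = _ := by rw [← Real.exp_nat_mul, mul_one]; push_cast; rfl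
  calc ((univ.filter fun Ls : Fin d → LatinSquare n => ¬ goodL Ls).card : ℝ)
      ≤ ((P.biUnion bad).card : ℝ) := by exact_mod_cast Finset.card_le_card hsub
    _ ≤ ∑ x ∈ P, ((bad x).card : ℝ) := by exact_mod_cast Finset.card_biUnion_le
    _ ≤ ∑ x ∈ P, (Fintype.card (LatinSquare n) : ℝ) ^ d * Real.exp (-4 * (n : ℝ) ^ 2) := Finset.sum_le_sum hb
    _ = (P.card : ℝ) * ((Fintype.card (LatinSquare n) : ℝ) ^ d * Real.exp (-4 * (n : ℝ) ^ 2)) := by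
        rw [Finset.sum_const, nsmul_eq_mul]
    _ ≤ Real.exp (3 * (n : ℝ) ^ 2) * ((Fintype.card (LatinSquare n) : ℝ) ^ d * Real.exp (-4 * (n : ℝ) ^ 2)) :=
        mul_le_mul_of_nonneg_right hcX (by positivity)
    _ = (Fintype.card (LatinSquare n) : ℝ) ^ d * (Real.exp (3 * (n : ℝ) ^ 2) * Real.exp (-4 * (n : ℝ) ^ 2)) := by ring
    _ = _ := by
        rw [← Real.exp_add]; congr 2; ring

lemma coch_ext {n : ℕ} {φ η : Cochain1 n} (h1 : ∀ i j, φ.ab i j = η.ab i j) (h2 : ∀ i j, φ.ac i j = η.ac i j)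
    (h3 : ∀ i j, φ.bc i j = η.bc i j) : φ = η := by
  obtain ⟨a, b, c⟩ := φ
  obtain ⟨a', b', c'⟩ := η
  have e1 : a = a' := funext fun i => funext fun j => h1 i j
  have e2 : b = b' := funext fun i => funext fun j => h2 i j
  have e3 : c = c' := funext fun i => funext fun j => h3 i j
  rw [e1, e2, e3]

lemma add_d0_add {n : ℕ} (φ : Cochain1 n) (ψ ψ' : Fin 3 × Fin n → ZMod 2) :
    φ + d0 ψ + d0 ψ' = φ + d0 (ψ + ψ') := by
  refine coch_ext (fun i j => ?_) (fun i j => ?_) (fun i j => ?_)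
  · change φ.ab i j + (ψ (0, i) + ψ (1, j)) + (ψ' (0, i) + ψ' (1, j)) =
      φ.ab i j + ((ψ (0, i) + ψ' (0, i)) + (ψ (1, j) + ψ' (1, j)))
    ring
  · change φ.ac i j + (ψ (0, i) + ψ (2, j)) + (ψ' (0, i) + ψ' (2, j)) =
      φ.ac i j + ((ψ (0, i) + ψ' (0, i)) + (ψ (2, j) + ψ' (2, j)))
    ring
  · change φ.bc i j + (ψ (1, i) + ψ (2, j)) + (ψ' (1, i) + ψ' (2, j)) =
      φ.bc i j + ((ψ (1, i) + ψ' (1, i)) + (ψ (2, j) + ψ' (2, j)))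
    ring

lemma d1_add_d0 {n : ℕ} (φ : Cochain1 n) (ψ : Fin 3 × Fin n → ZMod 2) (i j k : Fin n) :
    d1 (φ + d0 ψ) i j k = d1 φ i j k := by
  have t2 : (2 : ZMod 2) = 0 := by decide
  change φ.ab i j + (ψ (0, i) + ψ (1, j)) + (φ.ac i k + (ψ (0, i) + ψ (2, k))) +
    (φ.bc j k + (ψ (1, j) + ψ (2, k))) = φ.ab i j + φ.ac i k + φ.bc j k
  linear_combination (ψ (0, i) + ψ (1, j) + ψ (2, k)) * t2

lemma normd1_add_d0 {n : ℕ} (T : Finset (Fin n × Fin n × Fin n)) (φ : Cochain1 n) (ψ : Fin 3 × Fin n → ZMod 2) :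
    normd1 T (φ + d0 ψ) = normd1 T φ := by
  unfold normd1; simp only [d1_add_d0]

lemma exists_min {n : ℕ} (φ : Cochain1 n) : ∃ ψ, norm1 (φ + d0 ψ) = normClass1 φ ∧
    ∀ ψ', norm1 (φ + d0 ψ) ≤ norm1 (φ + d0 ψ') := by
  have hne : (Set.range fun ψ : Fin 3 × Fin n → ZMod 2 => norm1 (φ + d0 ψ)).Nonempty := Set.range_nonempty _
  obtain ⟨ψ, hψ⟩ := Nat.sInf_mem hne
  refine ⟨ψ, hψ, fun ψ' => ?_⟩
  have h : normClass1 φ ≤ norm1 (φ + d0 ψ') := Nat.sInf_le ⟨ψ', rfl⟩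
  have h2 : norm1 (φ + d0 ψ) = normClass1 φ := hψ
  omega

lemma cob_of_zero {n : ℕ} (φ : Cochain1 n) (ψ : Fin 3 × Fin n → ZMod 2) (h : norm1 (φ + d0 ψ) = 0) :
    IsCobound1 φ := by
  have t : ∀ a b : ZMod 2, a + b = 0 → a = b := by decide
  unfold norm1 at h
  simp only [Nat.add_eq_zero_iff, Finset.card_eq_zero, Finset.filter_eq_empty_iff, Finset.mem_univ, true_imp_iff,
    not_not] at h
  obtain ⟨⟨h1, h2⟩, h3⟩ := h
  refine ⟨ψ, coch_ext (fun i j => ?_) (fun i j => ?_) (fun i j => ?_)⟩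
  · exact t _ _ (h1 (x := (i, j)))
  · exact t _ _ (h2 (x := (i, j)))
  · exact t _ _ (h3 (x := (i, j)))

lemma norm1_le {n : ℕ} (φ : Cochain1 n) : norm1 φ ≤ 3 * n ^ 2 := by
  rw [norm1_sum]
  have h : ∀ f : Fin n → Fin n → ZMod 2, ∑ i, ∑ j, zi (f i j) ≤ n ^ 2 := by
    intro f
    calc ∑ i, ∑ j, zi (f i j) ≤ ∑ _i : Fin n, ∑ _j : Fin n, 1 :=
          Finset.sum_le_sum fun i _ => Finset.sum_le_sum fun j _ => zi_le _
      _ = n ^ 2 := by simp [pow_two]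
  have h1 := h φ.ab
  have h2 := h φ.ac
  have h3 := h φ.bc
  omega

lemma exists_noncob {n : ℕ} (hn : 1 ≤ n) : ∃ φ : Cochain1 n, ¬ IsCobound1 φ := by
  let o : Fin n := ⟨0, hn⟩
  refine ⟨⟨fun _ _ => 1, fun _ _ => 0, fun _ _ => 0⟩, ?_⟩
  rintro ⟨ψ, h⟩
  have h1 : (1 : ZMod 2) = ψ (0, o) + ψ (1, o) := congrFun (congrFun (congrArg Cochain1.ab h) o) o
  have h2 : (0 : ZMod 2) = ψ (0, o) + ψ (2, o) := congrFun (congrFun (congrArg Cochain1.ac h) o) o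
  have h3 : (0 : ZMod 2) = ψ (1, o) + ψ (2, o) := congrFun (congrFun (congrArg Cochain1.bc h) o) o
  revert h1 h2 h3
  generalize ψ (0, o) = a
  generalize ψ (1, o) = b
  generalize ψ (2, o) = c
  revert a b c
  decide

lemma h1_good {n d : ℕ} (hn : 1 ≤ n) (hd : 0 < d) (Ls : Fin d → LatinSquare n) (hg : goodE Ls) (hl : goodL Ls) :
    (10 : ℝ) ^ (-(11 : ℤ)) < h1 (triangles Ls) := by
  have hn0 : (0 : ℝ) < n := by exact_mod_cast hn
  have hε : (10 : ℝ) ^ (-(11 : ℤ)) < 2 / 10 ^ 11 := by norm_num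
  refine hε.trans_le ?_
  unfold h1
  refine le_csInf ?_ ?_
  · obtain ⟨φ, hφ⟩ := exists_noncob hn
    exact ⟨_, φ, hφ, rfl⟩
  · rintro r ⟨φ, hφ, rfl⟩
    obtain ⟨ψ, h1, h2⟩ := exists_min φ
    have hpos : 0 < normClass1 φ := by
      rw [← h1]
      rcases Nat.eq_zero_or_pos (norm1 (φ + d0 ψ)) with h | h
      · exact absurd (cob_of_zero φ ψ h) hφ
      · exact h
    have hpos' : (0 : ℝ) < normClass1 φ := by exact_mod_cast hpos
    rw [le_div_iff₀ hpos']
    by_cases hs : (normClass1 φ : ℝ) ≤ 1 / 10 ^ 6 * n ^ 2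
    · have h3 := small_main hn hd Ls hg (φ + d0 ψ) (fun ψ' => by rw [add_d0_add]; exact h2 _)
        (by rw [h1]; exact hs)
      rw [normd1_add_d0, h1] at h3
      refine le_trans ?_ h3
      exact mul_le_mul_of_nonneg_right (by norm_num) hpos'.le
    · push Not at hs
      have h3 : (n : ℝ) * normClass1 φ ≤ 7 * (Dset φ).card := by exact_mod_cast Dset_large hn φ
      have h4 : 1 / (7 * 10 ^ 6) * (n : ℝ) ^ 3 < (Dset φ).card := by
        have := mul_lt_mul_of_pos_left hs hn0
        have e : (n : ℝ) * (1 / 10 ^ 6 * n ^ 2) = 7 * (1 / (7 * 10 ^ 6) * (n : ℝ) ^ 3) := by ring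
        linarith
      have h5 := hl φ h4
      have h6 : (normClass1 φ : ℝ) ≤ 3 * n ^ 2 := by
        rw [← h1]; exact_mod_cast norm1_le (φ + d0 ψ)
      linarith

lemma latin_ratio {n d : ℕ} (hd : (d : ℝ) = 10 ^ 11) (hbig : (10 : ℝ) ^ 10 ≤ Real.sqrt n) :
    1 - (24 / (n : ℝ) + Real.exp (-(n : ℝ) ^ 2)) ≤
      ((univ.filter fun Ls : Fin d → LatinSquare n =>
            ((10 : ℝ) ^ (-(11 : ℤ)) : ℝ) < h1 (triangles Ls)).card : ℝ) /
          ((univ : Finset (Fin d → LatinSquare n)).card : ℝ) := by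
  have hn : 1 ≤ n := by
    rcases Nat.eq_zero_or_pos n with h | h
    · rw [h] at hbig; norm_num at hbig
    · exact h
  have hd' : 0 < d := by
    rcases Nat.eq_zero_or_pos d with h | h
    · rw [h] at hd; norm_num at hd
    · exact h
  have hN : (0 : ℝ) < (Fintype.card (LatinSquare n) : ℝ) :=
    (Real.exp_pos _).trans_le (latin_lower n hn)
  have hc : ((univ : Finset (Fin d → LatinSquare n)).card : ℝ) = (Fintype.card (LatinSquare n) : ℝ) ^ d := by
    rw [Finset.card_univ, Fintype.card_fun, Fintype.card_fin]; push_cast; rfl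
  have hsub : (univ : Finset (Fin d → LatinSquare n)) ⊆
      (univ.filter fun Ls : Fin d → LatinSquare n => ((10 : ℝ) ^ (-(11 : ℤ)) : ℝ) < h1 (triangles Ls)) ∪
      ((univ.filter fun Ls : Fin d → LatinSquare n => ¬ goodE Ls) ∪
        (univ.filter fun Ls : Fin d → LatinSquare n => ¬ goodL Ls)) := by
    intro Ls _
    simp only [Finset.mem_union, Finset.mem_filter, Finset.mem_univ, true_and]
    by_cases hg : goodE Ls
    · by_cases hl : goodL Ls
      · exact Or.inl (h1_good hn hd' Ls hg hl)
      · exact Or.inr (Or.inr hl)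
    · exact Or.inr (Or.inl hg)
  have h1 := (Finset.card_le_card hsub).trans ((Finset.card_union_le _ _).trans
    (Nat.add_le_add_left (Finset.card_union_le _ _) _))
  have h2 : ((univ : Finset (Fin d → LatinSquare n)).card : ℝ) ≤ _ := Nat.cast_le.2 h1
  rw [Nat.cast_add, Nat.cast_add, hc] at h2
  have h3 := goodE_prob (n := n) (d := d) hn hd
  have h4 := goodL_prob (n := n) (d := d) hn hd hbig
  rw [hc, le_div_iff₀ (pow_pos hN d)]
  have e : (1 - (24 / (n : ℝ) + Real.exp (-(n : ℝ) ^ 2))) * (Fintype.card (LatinSquare n) : ℝ) ^ d =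
    (Fintype.card (LatinSquare n) : ℝ) ^ d - ((Fintype.card (LatinSquare n) : ℝ) ^ d * (24 / n) +
    (Fintype.card (LatinSquare n) : ℝ) ^ d * Real.exp (-(n : ℝ) ^ 2)) := by ring
  rw [e]
  exact sub_le_iff_le_add.2 (h2.trans (add_le_add le_rfl (add_le_add h3 h4)))

lemma latin_tendsto (d : ℕ) (hd : (d : ℝ) = 10 ^ 11) :
    Filter.Tendsto
      (fun n : ℕ =>
        ((univ.filter fun Ls : Fin d → LatinSquare n =>
            ((10 : ℝ) ^ (-(11 : ℤ)) : ℝ) < h1 (triangles Ls)).card : ℝ) /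
          ((univ : Finset (Fin d → LatinSquare n)).card : ℝ))
      Filter.atTop (nhds 1) := by
  have hlim : Filter.Tendsto (fun n : ℕ => 1 - (24 / (n : ℝ) + Real.exp (-(n : ℝ) ^ 2))) Filter.atTop (nhds 1) := by
    have h1 : Filter.Tendsto (fun n : ℕ => 24 / (n : ℝ)) Filter.atTop (nhds 0) :=
      tendsto_const_div_atTop_nhds_zero_nat 24
    have h2 : Filter.Tendsto (fun n : ℕ => Real.exp (-(n : ℝ) ^ 2)) Filter.atTop (nhds 0) := by
      refine Real.tendsto_exp_neg_atTop_nhds_zero.comp ?_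
      exact (Filter.tendsto_pow_atTop (by norm_num)).comp tendsto_natCast_atTop_atTop
    have := (tendsto_const_nhds (x := (1 : ℝ))).sub (h1.add h2)
    simpa using this
  refine tendsto_of_tendsto_of_tendsto_of_le_of_le' hlim tendsto_const_nhds ?_ ?_
  · filter_upwards [Filter.eventually_ge_atTop (10 ^ 20)] with n hn
    refine latin_ratio hd ?_
    apply Real.le_sqrt_of_sq_le
    have : ((10 ^ 20 : ℕ) : ℝ) ≤ n := Nat.cast_le.2 hn
    push_cast at this
    calc ((10 : ℝ) ^ 10) ^ 2 = 10 ^ 20 := by norm_num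
      _ ≤ (n : ℝ) := le_trans (by norm_num) this
  · refine Filter.Eventually.of_forall fun n => ?_
    refine div_le_one_of_le₀ ?_ (Nat.cast_nonneg _)
    exact Nat.cast_le.2 (Finset.card_le_card (Finset.filter_subset _ _))

/-- **Theorem.** With the explicit constants `d = 10^11` and `ε = 10^{-11}`, the
probability that `Y ∈ 𝓨(n,d)` satisfies `h_1(Y) > ε` tends to `1` as `n → ∞`. -/
theorem latin_square_expanders_explicit_constants :
    Filter.Tendsto
      (fun n : ℕ =>
        (((univ : Finset (Fin (10 ^ 11) → LatinSquare n)).filter fun Ls =>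
            ((10 : ℝ) ^ (-(11 : ℤ)) : ℝ) < h1 (triangles Ls)).card : ℝ) /
          ((univ : Finset (Fin (10 ^ 11) → LatinSquare n)).card : ℝ))
      Filter.atTop (nhds 1) := by
  exact latin_tendsto (10 ^ 11) (by norm_num)
end
end

section
/- Let 0 < c < 1 and let G be a finite graph with m edges such that m ≤ c·n² and every vertex of G has degree at most n. Then Σ_{v} deg(v)² ≤ (1 + 3c^{1/3})·m·n, where the sum is over all vertices of G. -/
open Finset
open scoped Classical

noncomputable section

/-- **Claim.** Let `0 < c < 1` and let `G` be a finite graph with `m` edges such that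
`m ≤ c·n²` and every vertex of `G` has degree at most `n`.  Then
`Σ_v deg(v)² ≤ (1 + 3·c^{1/3})·m·n`. -/
theorem sum_degree_sq_le {V : Type*} [Fintype V] [DecidableEq V]
    (G : SimpleGraph V) [DecidableRel G.Adj] (n : ℕ) (c : ℝ)
    (hc0 : 0 < c) (hc1 : c < 1)
    (hm : (G.edgeFinset.card : ℝ) ≤ c * (n : ℝ) ^ 2)
    (hdeg : ∀ v : V, G.degree v ≤ n) :
    (∑ v : V, (G.degree v : ℝ) ^ 2) ≤
      (1 + 3 * c ^ ((1 : ℝ) / 3)) * (G.edgeFinset.card : ℝ) * (n : ℝ) := by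
  obtain ⟨t, ht⟩ : ∃ t : ℝ, t = c ^ ((1 : ℝ) / 3) := ⟨_, rfl⟩
  rw [← ht]
  have ht0 : 0 < t := ht ▸ Real.rpow_pos_of_pos hc0 _
  have ht1 : t < 1 := ht ▸ Real.rpow_lt_one hc0.le hc1 (by norm_num)
  have ht3 : t ^ 3 = c := by
    rw [ht, ← Real.rpow_natCast, ← Real.rpow_mul hc0.le]; norm_num
  rcases Nat.eq_zero_or_pos n with hn | hn
  · have h0 : ∀ v, G.degree v = 0 := fun v => by have := hdeg v; omega
    simp [h0, hn]
  have hn' : (0 : ℝ) < n := by exact_mod_cast hn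
  have hd : ∀ v, (G.degree v : ℝ) ≤ n := fun v => by exact_mod_cast hdeg v
  have hdeg' : ∀ v, (G.degree v : ℝ) = ∑ u : V, if G.Adj v u then (1 : ℝ) else 0 := by
    intro v
    rw [Finset.sum_boole, ← G.card_neighborFinset_eq_degree, G.neighborFinset_eq_filter]
  have hsum : ∑ v, (G.degree v : ℝ) = 2 * (G.edgeFinset.card : ℝ) := by
    exact_mod_cast G.sum_degrees_eq_twice_card_edges
  generalize (G.edgeFinset.card : ℝ) = m at *
  have e1 : ∑ v : V, (G.degree v : ℝ) ^ 2
      = ∑ v : V, ∑ u : V, if G.Adj v u then (G.degree v : ℝ) else 0 := by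
    refine Finset.sum_congr rfl fun v _ => ?_
    rw [sq]
    nth_rewrite 2 [hdeg' v]
    rw [Finset.mul_sum]
    refine Finset.sum_congr rfl fun u _ => ?_
    split_ifs <;> simp
  have e2 : ∑ v : V, (G.degree v : ℝ) ^ 2
      = ∑ v : V, ∑ u : V, if G.Adj v u then (G.degree u : ℝ) else 0 := by
    rw [e1, Finset.sum_comm]
    simp only [G.adj_comm]
  obtain ⟨f, hf⟩ : ∃ f : V → ℝ, ∀ v, f v = if t * n < (G.degree v : ℝ) then (1 : ℝ) else 0 :=
    ⟨_, fun _ => rfl⟩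
  have hf0 : ∀ v, 0 ≤ f v := fun v => by rw [hf]; split_ifs <;> norm_num
  have key : ∀ v u, (if G.Adj v u then (G.degree v : ℝ) else 0)
      + (if G.Adj v u then (G.degree u : ℝ) else 0)
      ≤ ((1 + t) * n) * (if G.Adj v u then (1 : ℝ) else 0) + ((1 - t) * n) * (f v * f u) := by
    intro v u
    have h1 := hd v
    have h2 := hd u
    by_cases ha : G.Adj v u
    · simp only [ha, if_true]
      rw [hf v, hf u]
      split_ifs <;> nlinarith
    · simp only [ha, if_false]
      have : 0 ≤ ((1 - t) * n) * (f v * f u) :=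
        mul_nonneg (mul_nonneg (by linarith) hn'.le) (mul_nonneg (hf0 v) (hf0 u))
      linarith
  have tot : 2 * ∑ v : V, (G.degree v : ℝ) ^ 2
      ≤ ((1 + t) * n) * (2 * m) + ((1 - t) * n) * ((∑ v, f v) * (∑ v, f v)) := by
    have := Finset.sum_le_sum fun v (_ : v ∈ (Finset.univ : Finset V)) =>
      Finset.sum_le_sum fun u (_ : u ∈ (Finset.univ : Finset V)) => key v u
    simp only [Finset.sum_add_distrib, ← Finset.mul_sum] at this
    rw [← e1, ← e2] at this
    simp only [← hdeg', hsum, ← Finset.sum_mul] at this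
    linarith
  have hH : t * n * ∑ v, f v ≤ 2 * m := by
    rw [← hsum, Finset.mul_sum]
    refine Finset.sum_le_sum fun v _ => ?_
    rw [hf]
    split_ifs with h
    · linarith
    · simp
  obtain ⟨s, hs⟩ : ∃ s, s = ∑ v, f v := ⟨_, rfl⟩
  have hs0 : 0 ≤ s := hs ▸ Finset.sum_nonneg fun v _ => hf0 v
  rw [← hs] at hH tot
  have htn : 0 < t * n := mul_pos ht0 hn'
  have hm0 : 0 ≤ m := by nlinarith [mul_nonneg htn.le hs0]
  have hs2 : s * s ≤ 4 * m * t := by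
    have a1 : (t * n * s) * (t * n * s) ≤ (2 * m) * (2 * m) :=
      mul_self_le_mul_self (mul_nonneg htn.le hs0) hH
    have a2 : m * m ≤ m * (c * (n : ℝ) ^ 2) := mul_le_mul_of_nonneg_left hm hm0
    rw [← ht3] at a2
    have a3 : (t * n) ^ 2 * (s * s) ≤ (t * n) ^ 2 * (4 * m * t) := by nlinarith
    exact le_of_mul_le_mul_left a3 (by positivity)
  have b1 : ((1 - t) * n) * (s * s) ≤ n * (4 * m * t) := by
    have : (1 - t) * n ≤ n := by nlinarith
    exact mul_le_mul this hs2 (mul_nonneg hs0 hs0) hn'.le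
  nlinarith
end
end
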